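/- Let ρ be a bipartite state on ℂ^d ⊗ ℂ^d, d' < 2d the least prime power ≥ d, and suppose I_c(ρ) ≤ 1/(6 ln 2 · (d'+1)²). If ρ' is obtained from ρ by local operations and l qubits of (two-way) quantum communication, then I_c(ρ') − I_c(ρ) ≤ 2l + 2(d'+1)²√(2 I_c(ρ) ln 2) · log₂ d + η((d'+1)²√(2 I_c(ρ) ln 2)), where η(x) = −x log₂ x. -/

import Mathlib

open scoped BigOperators Classical ComplexOrder
open Matrix Kronecker

noncomputable section

/-- Shannon entropy (base 2) of a finitely supported nonnegative function. -/
def H2 {α : Type} [Fintype α] (p : α → ℝ) : ℝ := ∑ x, -(p x * Real.logb 2 (p x))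

/-- Marginal on the first factor. -/
def margA {α β : Type} [Fintype α] [Fintype β] (p : α × β → ℝ) : α → ℝ :=
  fun a => ∑ b, p (a, b)

/-- Marginal on the second factor. -/
def margB {α β : Type} [Fintype α] [Fintype β] (p : α × β → ℝ) : β → ℝ :=
  fun b => ∑ a, p (a, b)

/-- Classical mutual information (base 2) of a joint distribution. -/
def mi {α β : Type} [Fintype α] [Fintype β] (p : α × β → ℝ) : ℝ :=
  H2 (margA p) + H2 (margB p) - H2 p

/-- Kullback–Leibler divergence in bits. -/
def klDiv {α : Type} [Fintype α] (ν μ : α → ℝ) : ℝ :=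
  ∑ x, ν x * Real.logb 2 (ν x / μ x)

/-- ℓ₁ distance between two functions. -/
def l1 {α : Type} [Fintype α] (ν μ : α → ℝ) : ℝ := ∑ x, |ν x - μ x|

/-- `p` is a probability distribution. -/
def IsProb {α : Type} [Fintype α] (p : α → ℝ) : Prop :=
  (∀ x, 0 ≤ p x) ∧ ∑ x, p x = 1

/-- Probability of an event. -/
def prE {Ω : Type} [Fintype Ω] (p : Ω → ℝ) (E : Ω → Prop) : ℝ :=
  ∑ ω, if E ω then p ω else 0

/-- Conditional distribution given an event. -/
def condP {Ω : Type} [Fintype Ω] (p : Ω → ℝ) (E : Ω → Prop) : Ω → ℝ :=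
  fun ω => if E ω then p ω / prE p E else 0

/-- Distribution of a random variable. -/
def distOf {Ω α : Type} [Fintype Ω] (p : Ω → ℝ) (X : Ω → α) : α → ℝ :=
  fun x => prE p (fun ω => X ω = x)

/-- Joint distribution of a pair of random variables. -/
def jointOf {Ω α β : Type} [Fintype Ω] (p : Ω → ℝ) (X : Ω → α) (Y : Ω → β)
    [Fintype α] [Fintype β] : α × β → ℝ :=
  fun xy => prE p (fun ω => X ω = xy.1 ∧ Y ω = xy.2)

/-- Mutual information between two random variables on a finite probability space. -/
def miRV {Ω α β : Type} [Fintype Ω] [Fintype α] [Fintype β]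
    (p : Ω → ℝ) (X : Ω → α) (Y : Ω → β) : ℝ :=
  mi (jointOf p X Y)



/-- A density matrix: positive semidefinite with unit trace. -/
def IsDensity {n : Type} [Fintype n] [DecidableEq n] (ρ : Matrix n n ℂ) : Prop :=
  ρ.PosSemidef ∧ ρ.trace = 1

/-- A POVM: positive semidefinite elements summing to the identity. -/
def IsPOVM {n ι : Type} [Fintype n] [DecidableEq n] [Fintype ι]
    (M : ι → Matrix n n ℂ) : Prop :=
  (∀ i, (M i).PosSemidef) ∧ ∑ i, M i = 1

/-- Partial trace over the second (Bob) factor: Alice's reduced state. -/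
def trOutB {A B : Type} [Fintype A] [Fintype B]
    (ρ : Matrix (A × B) (A × B) ℂ) : Matrix A A ℂ :=
  Matrix.of fun a a' => ∑ b, ρ (a, b) (a', b)

/-- Partial trace over the first (Alice) factor: Bob's reduced state. -/
def trOutA {A B : Type} [Fintype A] [Fintype B]
    (ρ : Matrix (A × B) (A × B) ℂ) : Matrix B B ℂ :=
  Matrix.of fun b b' => ∑ a, ρ (a, b) (a, b')

/-- von Neumann entropy in bits (via the eigenvalues of a Hermitian matrix). -/
def vN {n : Type} [Fintype n] [DecidableEq n] (ρ : Matrix n n ℂ) : ℝ :=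
  if h : ρ.IsHermitian then ∑ i, -(h.eigenvalues i * Real.logb 2 (h.eigenvalues i)) else 0

/-- Quantum mutual information `S(ρ_A) + S(ρ_B) − S(ρ_AB)` in bits. -/
def Iq {A B : Type} [Fintype A] [DecidableEq A] [Fintype B] [DecidableEq B]
    (ρ : Matrix (A × B) (A × B) ℂ) : ℝ :=
  vN (trOutB ρ) + vN (trOutA ρ) - vN ρ

/-- Trace norm (sum of singular values). -/
def traceNorm {n : Type} [Fintype n] [DecidableEq n] (M : Matrix n n ℂ) : ℝ :=
  ∑ i, Real.sqrt ((Matrix.posSemidef_conjTranspose_mul_self M).1.eigenvalues i)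

/-- Outcome distribution of a local measurement `M_A ⊗ M_B` on a bipartite state. -/
def outcomeProb {A B J K : Type} [Fintype A] [Fintype B] [Fintype J] [Fintype K]
    (ρ : Matrix (A × B) (A × B) ℂ)
    (MA : J → Matrix A A ℂ) (MB : K → Matrix B B ℂ) : J × K → ℝ :=
  fun jk => ((MA jk.1 ⊗ₖ MB jk.2) * ρ).trace.re

/-- The set of classical mutual informations achievable by local POVMs. -/
def IcSet {A B : Type} [Fintype A] [DecidableEq A] [Fintype B] [DecidableEq B]
    (ρ : Matrix (A × B) (A × B) ℂ) : Set ℝ :=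
  {r | ∃ (J K : Type) (_ : Fintype J) (_ : Fintype K)
        (MA : J → Matrix A A ℂ) (MB : K → Matrix B B ℂ),
        IsPOVM MA ∧ IsPOVM MB ∧ r = mi (outcomeProb ρ MA MB)}

/-- Maximal classical mutual information obtainable by local measurements. -/
def Ic {A B : Type} [Fintype A] [DecidableEq A] [Fintype B] [DecidableEq B]
    (ρ : Matrix (A × B) (A × B) ℂ) : ℝ :=
  sSup (IcSet ρ)

/-- Rank-one projector (outer product) `|v⟩⟨v|`. -/
def outer {n : Type} [Fintype n] (v : n → ℂ) : Matrix n n ℂ :=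
  Matrix.of fun i i' => v i * star (v i')

/-- The expectation `⟨φ|M|φ⟩` (real part). -/
def qexp {n : Type} [Fintype n] (φ : n → ℂ) (M : Matrix n n ℂ) : ℝ :=
  (∑ i, ∑ i', star (φ i) * M i i' * φ i').re

/-- The set of mutual informations between the ensemble label and the outcome of a POVM. -/
def IaccSet {n I : Type} [Fintype n] [DecidableEq n] [Fintype I]
    (p : I → ℝ) (η : I → Matrix n n ℂ) : Set ℝ :=
  {r | ∃ (J : Type) (_ : Fintype J) (M : J → Matrix n n ℂ), IsPOVM M ∧
        r = mi (fun ij : I × J => p ij.1 * ((M ij.2) * (η ij.1)).trace.re)}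

/-- Accessible information of an ensemble. -/
def Iacc {n I : Type} [Fintype n] [DecidableEq n] [Fintype I]
    (p : I → ℝ) (η : I → Matrix n n ℂ) : ℝ :=
  sSup (IaccSet p η)

/-- Matrix logarithm (base 2) of a Hermitian matrix, via spectral decomposition. -/
def matLog {n : Type} [Fintype n] [DecidableEq n] (M : Matrix n n ℂ) : Matrix n n ℂ :=
  if h : M.IsHermitian then
    (h.eigenvectorUnitary : Matrix n n ℂ) *
      Matrix.diagonal (fun i => (Real.logb 2 (h.eigenvalues i) : ℂ)) *
      star (h.eigenvectorUnitary : Matrix n n ℂ)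
  else 0

/-- Quantum relative entropy `Tr ν log₂ ν − Tr ν log₂ μ`. -/
def qRelEnt {n : Type} [Fintype n] [DecidableEq n] (ν μ : Matrix n n ℂ) : ℝ :=
  ((ν * matLog ν).trace - (ν * matLog μ).trace).re

/-- `Reach A B ρ l A' B' ρ'` : the bipartite state `ρ'` (Alice holding `A'`, Bob holding
`B'`) can be obtained from the bipartite state `ρ` (Alice holding `A`, Bob holding `B`) by
local quantum operations (CPTP maps, given by Kraus operators) together with `l` qubits of
two-way quantum communication (each communicated qubit is a two-dimensional subsystem
moved across the cut). -/
inductive Reach :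
    ∀ (A B : Type) [Fintype A] [DecidableEq A] [Fintype B] [DecidableEq B],
      Matrix (A × B) (A × B) ℂ → ℕ →
    ∀ (A' B' : Type) [Fintype A'] [DecidableEq A'] [Fintype B'] [DecidableEq B'],
      Matrix (A' × B') (A' × B') ℂ → Prop where
  | refl {A B : Type} [Fintype A] [DecidableEq A] [Fintype B] [DecidableEq B]
      (ρ : Matrix (A × B) (A × B) ℂ) :
      Reach A B ρ 0 A B ρ
  | localA {A B : Type} [Fintype A] [DecidableEq A] [Fintype B] [DecidableEq B]
      {ρ : Matrix (A × B) (A × B) ℂ} {l : ℕ}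
      {A₁ B₁ : Type} [Fintype A₁] [DecidableEq A₁] [Fintype B₁] [DecidableEq B₁]
      {σ : Matrix (A₁ × B₁) (A₁ × B₁) ℂ}
      {A₂ : Type} [Fintype A₂] [DecidableEq A₂]
      {ι : Type} [Fintype ι] (K : ι → Matrix A₂ A₁ ℂ)
      (hK : ∑ i, (K i)ᴴ * K i = 1) :
      Reach A B ρ l A₁ B₁ σ →
      Reach A B ρ l A₂ B₁
        (∑ i, (K i ⊗ₖ (1 : Matrix B₁ B₁ ℂ)) * σ * (K i ⊗ₖ (1 : Matrix B₁ B₁ ℂ))ᴴ)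
  | localB {A B : Type} [Fintype A] [DecidableEq A] [Fintype B] [DecidableEq B]
      {ρ : Matrix (A × B) (A × B) ℂ} {l : ℕ}
      {A₁ B₁ : Type} [Fintype A₁] [DecidableEq A₁] [Fintype B₁] [DecidableEq B₁]
      {σ : Matrix (A₁ × B₁) (A₁ × B₁) ℂ}
      {B₂ : Type} [Fintype B₂] [DecidableEq B₂]
      {ι : Type} [Fintype ι] (K : ι → Matrix B₂ B₁ ℂ)
      (hK : ∑ i, (K i)ᴴ * K i = 1) :
      Reach A B ρ l A₁ B₁ σ →
      Reach A B ρ l A₁ B₂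
        (∑ i, ((1 : Matrix A₁ A₁ ℂ) ⊗ₖ K i) * σ * ((1 : Matrix A₁ A₁ ℂ) ⊗ₖ K i)ᴴ)
  | sendA {A B : Type} [Fintype A] [DecidableEq A] [Fintype B] [DecidableEq B]
      {ρ : Matrix (A × B) (A × B) ℂ} {l : ℕ}
      {A₁ Q B₁ : Type} [Fintype A₁] [DecidableEq A₁] [Fintype Q] [DecidableEq Q]
      [Fintype B₁] [DecidableEq B₁]
      (hQ : Fintype.card Q = 2)
      {σ : Matrix ((A₁ × Q) × B₁) ((A₁ × Q) × B₁) ℂ} :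
      Reach A B ρ l (A₁ × Q) B₁ σ →
      Reach A B ρ (l + 1) A₁ (Q × B₁)
        (Matrix.reindex (Equiv.prodAssoc A₁ Q B₁) (Equiv.prodAssoc A₁ Q B₁) σ)
  | sendB {A B : Type} [Fintype A] [DecidableEq A] [Fintype B] [DecidableEq B]
      {ρ : Matrix (A × B) (A × B) ℂ} {l : ℕ}
      {A₁ Q B₁ : Type} [Fintype A₁] [DecidableEq A₁] [Fintype Q] [DecidableEq Q]
      [Fintype B₁] [DecidableEq B₁]
      (hQ : Fintype.card Q = 2)
      {σ : Matrix (A₁ × (Q × B₁)) (A₁ × (Q × B₁)) ℂ} :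
      Reach A B ρ l A₁ (Q × B₁) σ →
      Reach A B ρ (l + 1) (A₁ × Q) B₁
        (Matrix.reindex (Equiv.prodAssoc A₁ Q B₁).symm (Equiv.prodAssoc A₁ Q B₁).symm σ)

lemma mi_mul_log_two {α β : Type} [Fintype α] [Fintype β] (p : α × β → ℝ) :
    mi p * Real.log 2 =
      ∑ x, p x * (Real.log (p x) - Real.log (margA p x.1) - Real.log (margB p x.2)) := by
  have h2 : Real.log 2 ≠ 0 := by positivity
  have hA : H2 (margA p) * Real.log 2 = ∑ x, -(p x * Real.log (margA p x.1)) := by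
    rw [Fintype.sum_prod_type, H2, Finset.sum_mul]
    refine Finset.sum_congr rfl fun a _ => ?_
    dsimp only
    rw [Finset.sum_neg_distrib, ← Finset.sum_mul, Real.logb]
    change -(margA p a * _) * _ = -(margA p a * _)
    field_simp
  have hB : H2 (margB p) * Real.log 2 = ∑ x, -(p x * Real.log (margB p x.2)) := by
    rw [Fintype.sum_prod_type_right, H2, Finset.sum_mul]
    refine Finset.sum_congr rfl fun a _ => ?_
    dsimp only
    rw [Finset.sum_neg_distrib, ← Finset.sum_mul, Real.logb]
    change -(margB p a * _) * _ = -(margB p a * _)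
    field_simp
  have hP : H2 p * Real.log 2 = ∑ x, -(p x * Real.log (p x)) := by
    rw [H2, Finset.sum_mul]
    refine Finset.sum_congr rfl fun a _ => ?_
    rw [Real.logb]
    field_simp
  rw [mi, sub_mul, add_mul, hA, hB, hP, ← Finset.sum_add_distrib, ← Finset.sum_sub_distrib]
  exact Finset.sum_congr rfl fun x _ => by ring

lemma mul_log_sub_log_le {a b : ℝ} (ha : 0 ≤ a) (hb : 0 ≤ b) (hab : 0 < a → 0 < b) :
    a * (Real.log b - Real.log a) ≤ b - a := by
  rcases ha.eq_or_lt with rfl | ha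
  · simpa using hb
  · have hb' := hab ha
    rw [← Real.log_div hb'.ne' ha.ne']
    calc a * Real.log (b / a) ≤ a * (b / a - 1) :=
          mul_le_mul_of_nonneg_left (Real.log_le_sub_one_of_pos (by positivity)) ha.le
      _ = b - a := by field_simp

/-- The mutual information is the least relative entropy to a product distribution. -/
lemma mi_mul_log_two_le {α β : Type} [Fintype α] [Fintype β] {p : α × β → ℝ} (hp : IsProb p)
    {a : α → ℝ} {b : β → ℝ} (ha : IsProb a) (hb : IsProb b)
    (hpos : ∀ x, 0 < p x → 0 < a x.1 * b x.2) :
    mi p * Real.log 2 ≤ ∑ x, p x * (Real.log (p x) - Real.log (a x.1 * b x.2)) := by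
  have hA0 : ∀ i, 0 ≤ margA p i := fun i => Finset.sum_nonneg fun j _ => hp.1 _
  have hB0 : ∀ i, 0 ≤ margB p i := fun i => Finset.sum_nonneg fun j _ => hp.1 _
  have hA1 : ∑ i, margA p i = 1 := by
    rw [← hp.2, Fintype.sum_prod_type]; rfl
  have hB1 : ∑ i, margB p i = 1 := by
    rw [← hp.2, Fintype.sum_prod_type_right]; rfl
  have hApos : ∀ i, 0 < margA p i → 0 < a i := by
    intro i hi
    obtain ⟨j, -, hj⟩ := Finset.exists_lt_of_sum_lt (s := Finset.univ) (f := fun _ => (0 : ℝ))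
      (g := fun j => p (i, j)) (by simpa [margA] using hi)
    exact pos_of_mul_pos_left (hpos (i, j) hj) (hb.1 j)
  have hBpos : ∀ i, 0 < margB p i → 0 < b i := by
    intro i hi
    obtain ⟨j, -, hj⟩ := Finset.exists_lt_of_sum_lt (s := Finset.univ) (f := fun _ => (0 : ℝ))
      (g := fun j => p (j, i)) (by simpa [margB] using hi)
    exact pos_of_mul_pos_right (hpos (j, i) hj) (ha.1 j)
  have h1 : ∑ x, p x * (Real.log (a x.1) - Real.log (margA p x.1)) ≤ 0 := by
    calc ∑ x, p x * (Real.log (a x.1) - Real.log (margA p x.1))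
        = ∑ i, margA p i * (Real.log (a i) - Real.log (margA p i)) := by
          rw [Fintype.sum_prod_type]
          exact Finset.sum_congr rfl fun i _ => by dsimp only; rw [← Finset.sum_mul]; rfl
      _ ≤ ∑ i, (a i - margA p i) :=
          Finset.sum_le_sum fun i _ => mul_log_sub_log_le (hA0 i) (ha.1 i) (hApos i)
      _ = 0 := by rw [Finset.sum_sub_distrib, ha.2, hA1, sub_self]
  have h2 : ∑ x, p x * (Real.log (b x.2) - Real.log (margB p x.2)) ≤ 0 := by
    calc ∑ x, p x * (Real.log (b x.2) - Real.log (margB p x.2))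
        = ∑ i, margB p i * (Real.log (b i) - Real.log (margB p i)) := by
          rw [Fintype.sum_prod_type_right]
          exact Finset.sum_congr rfl fun i _ => by dsimp only; rw [← Finset.sum_mul]; rfl
      _ ≤ ∑ i, (b i - margB p i) :=
          Finset.sum_le_sum fun i _ => mul_log_sub_log_le (hB0 i) (hb.1 i) (hBpos i)
      _ = 0 := by rw [Finset.sum_sub_distrib, hb.2, hB1, sub_self]
  rw [mi_mul_log_two]
  have h3 : ∑ x, p x * (Real.log (p x) - Real.log (a x.1 * b x.2)) =
      ∑ x, p x * (Real.log (p x) - Real.log (margA p x.1) - Real.log (margB p x.2)) -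
      (∑ x, p x * (Real.log (a x.1) - Real.log (margA p x.1)) +
       ∑ x, p x * (Real.log (b x.2) - Real.log (margB p x.2))) := by
    rw [← Finset.sum_add_distrib, ← Finset.sum_sub_distrib]
    refine Finset.sum_congr rfl fun x _ => ?_
    rcases (hp.1 x).eq_or_lt with h | h
    · simp [← h]
    · have := hpos x h
      rw [Real.log_mul (left_ne_zero_of_mul this.ne') (right_ne_zero_of_mul this.ne')]
      ring
  linarith

lemma log_ge_rational {x : ℝ} (hx : 0 < x) :
    (x - 1) * (5 * x + 1) / (2 * x * (x + 2)) ≤ Real.log x := by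
  set f : ℝ → ℝ := fun x => Real.log x - (x - 1) * (5 * x + 1) / (2 * x * (x + 2)) with hf
  have hd : ∀ y : ℝ, 0 < y → HasDerivAt f ((y - 1) ^ 3 / (y ^ 2 * (y + 2) ^ 2)) y := by
    intro y hy
    have h1 : HasDerivAt (fun x : ℝ => (x - 1) * (5 * x + 1))
        (1 * (5 * y + 1) + (y - 1) * (5 * 1)) y :=
      ((hasDerivAt_id y).sub_const 1).mul (((hasDerivAt_id y).const_mul 5).add_const 1)
    have h2 : HasDerivAt (fun x : ℝ => 2 * x * (x + 2)) (2 * 1 * (y + 2) + 2 * y * 1) y :=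
      ((hasDerivAt_id y).const_mul 2).mul ((hasDerivAt_id y).add_const 2)
    have h := (Real.hasDerivAt_log hy.ne').sub (h1.div h2 (by positivity))
    refine h.congr_deriv ?_
    field_simp
    ring
  have hmin : f 1 ≤ f x := by
    rcases le_total 1 x with h | h
    · refine (monotoneOn_of_deriv_nonneg (convex_Icc 1 x) ?_ ?_ ?_)
        (Set.left_mem_Icc.2 h) (Set.right_mem_Icc.2 h) h
      · exact fun y hy => (hd y (by linarith [hy.1])).continuousAt.continuousWithinAt
      · rw [interior_Icc]
        exact fun y hy => (hd y (by linarith [hy.1])).differentiableAt.differentiableWithinAt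
      · rw [interior_Icc]
        intro y hy
        rw [(hd y (by linarith [hy.1])).deriv]
        have : 0 ≤ y - 1 := by linarith [hy.1]
        have : 0 < y := by linarith
        positivity
    · refine (antitoneOn_of_deriv_nonpos (convex_Icc x 1) ?_ ?_ ?_)
        (Set.left_mem_Icc.2 h) (Set.right_mem_Icc.2 h) h
      · exact fun y hy => (hd y (by linarith [hy.1])).continuousAt.continuousWithinAt
      · rw [interior_Icc]
        exact fun y hy => (hd y (by linarith [hy.1])).differentiableAt.differentiableWithinAt
      · rw [interior_Icc]
        intro y hy
        rw [(hd y (by linarith [hy.1])).deriv]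
        have h1 : (y - 1) ^ 3 ≤ 0 := by
          have : 0 ≤ (1 - y) ^ 3 := pow_nonneg (by linarith [hy.2]) 3
          nlinarith
        exact div_nonpos_of_nonpos_of_nonneg h1 (by positivity)
  simp only [hf, Real.log_one] at hmin
  norm_num at hmin
  exact hmin

lemma sq_sub_div_le_mul_log {p q : ℝ} (hp : 0 ≤ p) (hq : 0 ≤ q) (hpq : 0 < p → 0 < q) :
    3 / 2 * ((p - q) ^ 2 / (p + 2 * q)) ≤ p * (Real.log p - Real.log q) - p + q := by
  rcases hp.eq_or_lt with rfl | hp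
  · rcases hq.eq_or_lt with rfl | hq
    · simp
    · have : 3 / 2 * ((0 - q) ^ 2 / (0 + 2 * q)) = 3 / 4 * q := by field_simp; ring
      rw [this]; linarith
  · have hq := hpq hp
    have h := mul_le_mul_of_nonneg_left (log_ge_rational (div_pos hp hq)) hp.le
    rw [Real.log_div hp.ne' hq.ne'] at h
    have : 3 / 2 * ((p - q) ^ 2 / (p + 2 * q)) =
        p * ((p / q - 1) * (5 * (p / q) + 1) / (2 * (p / q) * (p / q + 2))) - p + q := by
      field_simp; ring
    linarith

/-- Pinsker's inequality, in nats. -/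
lemma sq_l1_le {α : Type} [Fintype α] {p q : α → ℝ} (hp : IsProb p) (hq : IsProb q)
    (hpq : ∀ x, 0 < p x → 0 < q x) :
    l1 p q ^ 2 ≤ 2 * ∑ x, p x * (Real.log (p x) - Real.log (q x)) := by
  have hs : ∑ x, (p x + 2 * q x) = 3 := by
    rw [Finset.sum_add_distrib, ← Finset.mul_sum, hp.2, hq.2]; norm_num
  have hcs : l1 p q ^ 2 ≤ (∑ x, (p x - q x) ^ 2 / (p x + 2 * q x)) * ∑ x, (p x + 2 * q x) := by
    refine Finset.sum_sq_le_sum_mul_sum_of_sq_le_mul Finset.univ (fun x _ => ?_) (fun x _ => ?_)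
      fun x _ => ?_
    · have := hp.1 x; have := hq.1 x; positivity
    · have := hp.1 x; have := hq.1 x; positivity
    · have h1 := hp.1 x
      have h2 := hq.1 x
      rw [sq_abs]
      by_cases h : p x + 2 * q x = 0
      · have h3 : p x = 0 := by linarith
        have h4 : q x = 0 := by linarith
        simp [h3, h4]
      · rw [div_mul_cancel₀ _ h]
  have hle := Finset.sum_le_sum fun x (_ : x ∈ Finset.univ) =>
    sq_sub_div_le_mul_log (hp.1 x) (hq.1 x) (hpq x)
  rw [← Finset.mul_sum, Finset.sum_add_distrib, Finset.sum_sub_distrib, hp.2, hq.2] at hle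
  rw [hs] at hcs
  linarith

lemma sum_mul_log_sub_log_le {α : Type} [Fintype α] {p c : α → ℝ} (hp : IsProb p) {M : ℝ}
    (hM : 0 < M) (h : ∀ x, p x ≤ M * c x) :
    ∑ x, p x * (Real.log (p x) - Real.log (c x)) ≤ Real.log M := by
  calc ∑ x, p x * (Real.log (p x) - Real.log (c x)) ≤ ∑ x, p x * Real.log M := by
        refine Finset.sum_le_sum fun x _ => ?_
        rcases (hp.1 x).eq_or_lt with h0 | h0
        · simp [← h0]
        · have hc : 0 < c x := pos_of_mul_pos_right (h0.trans_le (h x)) hM.le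
          have := Real.log_le_log h0 (h x)
          rw [Real.log_mul hM.ne' hc.ne'] at this
          exact mul_le_mul_of_nonneg_left (by linarith) h0.le
    _ = Real.log M := by rw [← Finset.sum_mul, hp.2, one_mul]

/-- Continuity bound of Audenaert type for the relative entropy to a mixture. -/
lemma sum_mul_log_sub_log_le_of_mix {α : Type} [Fintype α] {p q u c : α → ℝ} (hp : IsProb p)
    (hq : ∀ x, 0 ≤ q x) {K D t : ℝ} (hK : 0 < K) (hD : 2 ≤ D) (ht : 0 < t) (ht' : t ≤ 1 / 2)
    (hpu : ∀ x, p x ≤ D * u x) (hpq : ∑ x, max (p x - q x) 0 ≤ t)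
    (hc : ∀ x, (1 - t * D / (D - 1)) * q x + t * D / (D - 1) * u x ≤ K * c x) :
    ∑ x, p x * (Real.log (p x) - Real.log (c x)) ≤
      Real.log K + t * Real.log ((D - 1) / t) - (1 - t) * Real.log (1 - t) := by
  have hD1 : 0 < D - 1 := by linarith
  set r := t / (D - 1) with hr
  have hr0 : 0 < r := by positivity
  have hrt : r ≤ 1 - t := by
    have : r ≤ t := div_le_self ht.le (by linarith)
    linarith
  have hs : t * D / (D - 1) = t + r := by rw [hr]; field_simp; ring
  have hsD : t + r = r * D := by rw [← hs, hr]; field_simp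
  have hs1 : 0 ≤ 1 - (t + r) := by linarith
  rw [hs] at hc
  set W := ∑ x, max (p x - q x) 0 with hW
  have key : ∀ x, p x * (Real.log (p x) - Real.log (c x)) ≤
      p x * (Real.log K - Real.log (1 - t)) +
        max (p x - q x) 0 * (Real.log (1 - t) - Real.log r) := by
    intro x
    rcases (hp.1 x).eq_or_lt with h0 | h0
    · rw [← h0, max_eq_right (by linarith [hq x])]; simp
    set e := max (p x - q x) 0 with he
    have he0 : 0 ≤ e := le_max_right _ _
    have hep : e ≤ p x := max_le (by linarith [hq x]) h0.le
    have heq : p x - e ≤ q x := by linarith [le_max_left (p x - q x) 0]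
    have hconc := strictConcaveOn_log_Ioi.concaveOn.2 (Set.mem_Ioi.2 hr0)
      (Set.mem_Ioi.2 (hr0.trans_le hrt)) (show 0 ≤ e / p x by positivity)
      (show 0 ≤ (p x - e) / p x from div_nonneg (by linarith) h0.le) (by field_simp; ring)
    simp only [smul_eq_mul] at hconc
    have hy : 0 < e / p x * r + (p x - e) / p x * (1 - t) := by
      have : e / p x * r + (p x - e) / p x * r ≤ e / p x * r + (p x - e) / p x * (1 - t) := by
        have : 0 ≤ (p x - e) / p x := div_nonneg (by linarith) h0.le
        gcongr
      have h3 : e / p x * r + (p x - e) / p x * r = r := by field_simp; ring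
      linarith
    have hlow : p x * (e / p x * r + (p x - e) / p x * (1 - t)) ≤ K * c x := by
      refine le_trans ?_ (hc x)
      have h1 : p x * (e / p x * r + (p x - e) / p x * (1 - t)) =
          (1 - (t + r)) * (p x - e) + r * p x := by field_simp; ring
      have h2 : r * p x ≤ (t + r) * u x := by
        rw [hsD, mul_assoc]; exact mul_le_mul_of_nonneg_left (hpu x) hr0.le
      rw [h1]
      have := mul_le_mul_of_nonneg_left heq hs1
      linarith
    have hc0 : 0 < c x := pos_of_mul_pos_right ((mul_pos h0 hy).trans_le hlow) hK.le
    have hlog := Real.log_le_log (mul_pos h0 hy) hlow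
    rw [Real.log_mul h0.ne' hy.ne', Real.log_mul hK.ne' hc0.ne'] at hlog
    have h4 : Real.log (p x) - Real.log (c x) ≤
        Real.log K - (e / p x * Real.log r + (p x - e) / p x * Real.log (1 - t)) := by linarith
    calc _ ≤ p x * (Real.log K -
          (e / p x * Real.log r + (p x - e) / p x * Real.log (1 - t))) :=
          mul_le_mul_of_nonneg_left h4 h0.le
      _ = _ := by field_simp; ring
  have hlogr : Real.log r ≤ Real.log (1 - t) := Real.log_le_log hr0 hrt
  have hlr : Real.log ((D - 1) / t) = -Real.log r := by
    rw [hr, ← Real.log_inv, inv_div]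
  calc _ ≤ _ := Finset.sum_le_sum fun x _ => key x
    _ = (Real.log K - Real.log (1 - t)) + W * (Real.log (1 - t) - Real.log r) := by
        rw [Finset.sum_add_distrib, ← Finset.sum_mul, ← Finset.sum_mul, hp.2, one_mul]
    _ ≤ (Real.log K - Real.log (1 - t)) + t * (Real.log (1 - t) - Real.log r) := by
        have := mul_le_mul_of_nonneg_right hpq (sub_nonneg.2 hlogr)
        linarith
    _ = _ := by rw [hlr]; ring

lemma trace_mul_nonneg {n : Type} [Fintype n] [DecidableEq n] {M X : Matrix n n ℂ}
    (hM : M.PosSemidef) (hX : X.PosSemidef) : 0 ≤ (M * X).trace := by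
  obtain ⟨S, rfl⟩ := by
    open scoped MatrixOrder in
    exact CStarAlgebra.nonneg_iff_eq_star_mul_self.mp hX.nonneg
  rw [← Matrix.mul_assoc, Matrix.trace_mul_comm, ← Matrix.mul_assoc]
  exact (hM.mul_mul_conjTranspose_same S).trace_nonneg

lemma trace_kronecker_mul_kronecker {A B : Type} [Fintype A] [Fintype B]
    (M α : Matrix A A ℂ) (N β : Matrix B B ℂ) :
    ((M ⊗ₖ N) * (α ⊗ₖ β)).trace = (M * α).trace * (N * β).trace := by
  rw [← Matrix.mul_kronecker_mul, Matrix.trace_kronecker]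

lemma kronecker_sum_left {A B ι : Type} [Fintype ι] (f : ι → Matrix A A ℂ) (N : Matrix B B ℂ) :
    (∑ i, f i) ⊗ₖ N = ∑ i, f i ⊗ₖ N := by
  ext ⟨a, b⟩ ⟨a', b'⟩
  simp [Matrix.sum_apply, Matrix.kroneckerMap_apply, Finset.sum_mul]

lemma kronecker_sum_right {A B ι : Type} [Fintype ι] (M : Matrix A A ℂ) (f : ι → Matrix B B ℂ) :
    M ⊗ₖ (∑ i, f i) = ∑ i, M ⊗ₖ f i := by
  ext ⟨a, b⟩ ⟨a', b'⟩
  simp [Matrix.sum_apply, Matrix.kroneckerMap_apply, Finset.mul_sum]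

lemma outcomeProb_add {A B J K : Type} [Fintype A] [Fintype B] [Fintype J] [Fintype K]
    (X Y : Matrix (A × B) (A × B) ℂ) (MA : J → Matrix A A ℂ) (MB : K → Matrix B B ℂ) (x : J × K) :
    outcomeProb (X + Y) MA MB x = outcomeProb X MA MB x + outcomeProb Y MA MB x := by
  simp [outcomeProb, Matrix.mul_add]

lemma outcomeProb_sub {A B J K : Type} [Fintype A] [Fintype B] [Fintype J] [Fintype K]
    (X Y : Matrix (A × B) (A × B) ℂ) (MA : J → Matrix A A ℂ) (MB : K → Matrix B B ℂ) (x : J × K) :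
    outcomeProb (X - Y) MA MB x = outcomeProb X MA MB x - outcomeProb Y MA MB x := by
  simp [outcomeProb, Matrix.mul_sub]

lemma outcomeProb_smul {A B J K : Type} [Fintype A] [Fintype B] [Fintype J] [Fintype K]
    (r : ℝ) (X : Matrix (A × B) (A × B) ℂ) (MA : J → Matrix A A ℂ) (MB : K → Matrix B B ℂ)
    (x : J × K) : outcomeProb ((r : ℂ) • X) MA MB x = r * outcomeProb X MA MB x := by
  simp [outcomeProb]

lemma outcomeProb_nonneg {A B J K : Type} [Fintype A] [DecidableEq A] [Fintype B] [DecidableEq B]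
    [Fintype J] [Fintype K] {X : Matrix (A × B) (A × B) ℂ} (hX : X.PosSemidef)
    {MA : J → Matrix A A ℂ} {MB : K → Matrix B B ℂ} (hA : IsPOVM MA) (hB : IsPOVM MB)
    (x : J × K) : 0 ≤ outcomeProb X MA MB x :=
  (Complex.nonneg_iff.1 (trace_mul_nonneg ((hA.1 x.1).kronecker (hB.1 x.2)) hX)).1

lemma sum_outcomeProb {A B J K : Type} [Fintype A] [DecidableEq A] [Fintype B] [DecidableEq B]
    [Fintype J] [Fintype K] (X : Matrix (A × B) (A × B) ℂ)
    {MA : J → Matrix A A ℂ} {MB : K → Matrix B B ℂ} (hA : IsPOVM MA) (hB : IsPOVM MB) :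
    ∑ x, outcomeProb X MA MB x = X.trace.re := by
  have h : ∑ x : J × K, MA x.1 ⊗ₖ MB x.2 = (1 : Matrix (A × B) (A × B) ℂ) := by
    rw [Fintype.sum_prod_type]
    simp only [← kronecker_sum_right, ← kronecker_sum_left, hA.2, hB.2, Matrix.one_kronecker_one]
  simp only [outcomeProb]
  rw [← Complex.re_sum, ← Matrix.trace_sum, ← Matrix.sum_mul, h, Matrix.one_mul]

lemma isProb_outcomeProb {A B J K : Type} [Fintype A] [DecidableEq A] [Fintype B] [DecidableEq B]
    [Fintype J] [Fintype K] {X : Matrix (A × B) (A × B) ℂ} (hX : IsDensity X)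
    {MA : J → Matrix A A ℂ} {MB : K → Matrix B B ℂ} (hA : IsPOVM MA) (hB : IsPOVM MB) :
    IsProb (outcomeProb X MA MB) :=
  ⟨outcomeProb_nonneg hX.1 hA hB, by rw [sum_outcomeProb X hA hB, hX.2, Complex.one_re]⟩

/-- Outcome distribution of a POVM on a single system. -/
def povmProb {A J : Type} [Fintype A] (X : Matrix A A ℂ) (M : J → Matrix A A ℂ) : J → ℝ :=
  fun j => (M j * X).trace.re

lemma isProb_povmProb {A J : Type} [Fintype A] [DecidableEq A] [Fintype J] {X : Matrix A A ℂ}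
    (hX : IsDensity X) {M : J → Matrix A A ℂ} (hM : IsPOVM M) : IsProb (povmProb X M) := by
  refine ⟨fun j => (Complex.nonneg_iff.1 (trace_mul_nonneg (hM.1 j) hX.1)).1, ?_⟩
  simp only [povmProb]
  rw [← Complex.re_sum, ← Matrix.trace_sum, ← Matrix.sum_mul, hM.2, Matrix.one_mul, hX.2,
    Complex.one_re]

lemma outcomeProb_kronecker {A B J K : Type} [Fintype A] [DecidableEq A] [Fintype B]
    [DecidableEq B] [Fintype J] [Fintype K] {α : Matrix A A ℂ} {β : Matrix B B ℂ}
    (hα : α.PosSemidef) {MA : J → Matrix A A ℂ} (MB : K → Matrix B B ℂ) (hA : IsPOVM MA)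
    (x : J × K) :
    outcomeProb (α ⊗ₖ β) MA MB x = povmProb α MA x.1 * povmProb β MB x.2 := by
  have h := (Complex.nonneg_iff.1 (trace_mul_nonneg (hA.1 x.1) hα)).2
  rw [outcomeProb, trace_kronecker_mul_kronecker, Complex.mul_re, ← h]
  simp [povmProb]

lemma kronecker_one_kraus {A₁ A₂ B : Type} [Fintype A₁] [Fintype A₂] [Fintype B] [DecidableEq A₁]
    [DecidableEq B] {ι : Type} [Fintype ι] {K : ι → Matrix A₂ A₁ ℂ} (hK : ∑ i, (K i)ᴴ * K i = 1) :
    ∑ i, (K i ⊗ₖ (1 : Matrix B B ℂ))ᴴ * (K i ⊗ₖ (1 : Matrix B B ℂ)) = 1 := by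
  simp only [Matrix.conjTranspose_kronecker, ← Matrix.mul_kronecker_mul, Matrix.conjTranspose_one,
    Matrix.one_mul]
  rw [← kronecker_sum_left, hK, Matrix.one_kronecker_one]

lemma one_kronecker_kraus {A₁ A₂ B : Type} [Fintype A₁] [Fintype A₂] [Fintype B] [DecidableEq A₁]
    [DecidableEq B] {ι : Type} [Fintype ι] {K : ι → Matrix A₂ A₁ ℂ} (hK : ∑ i, (K i)ᴴ * K i = 1) :
    ∑ i, ((1 : Matrix B B ℂ) ⊗ₖ K i)ᴴ * ((1 : Matrix B B ℂ) ⊗ₖ K i) = 1 := by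
  simp only [Matrix.conjTranspose_kronecker, ← Matrix.mul_kronecker_mul, Matrix.conjTranspose_one,
    Matrix.one_mul]
  rw [← kronecker_sum_right, hK, Matrix.one_kronecker_one]

/-- The completely positive map with the given Kraus operators. -/
def krausMap {n m ι : Type} [Fintype n] [Fintype ι] (K : ι → Matrix m n ℂ) :
    Matrix n n ℂ →ₗ[ℂ] Matrix m m ℂ where
  toFun X := ∑ i, K i * X * (K i)ᴴ
  map_add' X Y := by simp [Matrix.mul_add, Matrix.add_mul, Finset.sum_add_distrib]
  map_smul' c X := by simp [Finset.smul_sum]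

lemma krausMap_posSemidef {n m ι : Type} [Fintype n] [Fintype m] [Fintype ι]
    (K : ι → Matrix m n ℂ) {X : Matrix n n ℂ} (hX : X.PosSemidef) :
    (krausMap K X).PosSemidef :=
  Matrix.posSemidef_sum _ fun i _ => hX.mul_mul_conjTranspose_same (K i)

lemma trace_krausMap {n m ι : Type} [Fintype n] [DecidableEq n] [Fintype m] [Fintype ι]
    {K : ι → Matrix m n ℂ} (hK : ∑ i, (K i)ᴴ * K i = 1) (X : Matrix n n ℂ) :
    (krausMap K X).trace = X.trace := by
  calc (krausMap K X).trace = ∑ i, ((K i)ᴴ * K i * X).trace := by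
        rw [krausMap, LinearMap.coe_mk, AddHom.coe_mk, Matrix.trace_sum]
        exact Finset.sum_congr rfl fun i _ => by rw [Matrix.trace_mul_comm, Matrix.mul_assoc]
    _ = X.trace := by rw [← Matrix.trace_sum, ← Matrix.sum_mul, hK, Matrix.one_mul]

lemma krausMap_kronecker_one {A₁ A₂ B : Type} [Fintype A₁] [Fintype A₂] [Fintype B] [DecidableEq A₁]
    [DecidableEq B] {ι : Type} [Fintype ι] (K : ι → Matrix A₂ A₁ ℂ) (α : Matrix A₁ A₁ ℂ)
    (β : Matrix B B ℂ) :
    krausMap (fun i => K i ⊗ₖ (1 : Matrix B B ℂ)) (α ⊗ₖ β) = krausMap K α ⊗ₖ β := by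
  simp only [krausMap, LinearMap.coe_mk, AddHom.coe_mk, Matrix.conjTranspose_kronecker,
    ← Matrix.mul_kronecker_mul, Matrix.conjTranspose_one, Matrix.one_mul, Matrix.mul_one]
  rw [kronecker_sum_left]

lemma krausMap_one_kronecker {A₁ A₂ B : Type} [Fintype A₁] [Fintype A₂] [Fintype B] [DecidableEq A₁]
    [DecidableEq B] {ι : Type} [Fintype ι] (K : ι → Matrix A₂ A₁ ℂ) (α : Matrix A₁ A₁ ℂ)
    (β : Matrix B B ℂ) :
    krausMap (fun i => (1 : Matrix B B ℂ) ⊗ₖ K i) (β ⊗ₖ α) = β ⊗ₖ krausMap K α := by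
  simp only [krausMap, LinearMap.coe_mk, AddHom.coe_mk, Matrix.conjTranspose_kronecker,
    ← Matrix.mul_kronecker_mul, Matrix.conjTranspose_one, Matrix.one_mul, Matrix.mul_one]
  rw [kronecker_sum_right]

lemma isDensity_krausMap {n m ι : Type} [Fintype n] [DecidableEq n] [Fintype m] [DecidableEq m]
    [Fintype ι] {K : ι → Matrix m n ℂ} (hK : ∑ i, (K i)ᴴ * K i = 1) {X : Matrix n n ℂ}
    (hX : IsDensity X) : IsDensity (krausMap K X) :=
  ⟨krausMap_posSemidef K hX.1, by rw [trace_krausMap hK, hX.2]⟩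

lemma trOutB_eq_sum {A Q : Type} [Fintype A] [DecidableEq A] [Fintype Q] (σ : Matrix (A × Q) (A × Q) ℂ) :
    trOutB σ = ∑ q, σ.submatrix (fun a => (a, q)) fun a => (a, q) := by
  ext a a'
  simp [trOutB, Matrix.sum_apply]

lemma trOutB_posSemidef {A Q : Type} [Fintype A] [DecidableEq A] [Fintype Q]
    {σ : Matrix (A × Q) (A × Q) ℂ} (hσ : σ.PosSemidef) : (trOutB σ).PosSemidef := by
  rw [trOutB_eq_sum]
  exact Matrix.posSemidef_sum _ fun q _ => hσ.submatrix _

lemma trace_trOutB {A Q : Type} [Fintype A] [Fintype Q] (σ : Matrix (A × Q) (A × Q) ℂ) :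
    (trOutB σ).trace = σ.trace := by
  simp [trOutB, Matrix.trace, Fintype.sum_prod_type]

lemma trOutA_posSemidef {A Q : Type} [Fintype A] [Fintype Q]
    {σ : Matrix (A × Q) (A × Q) ℂ} (hσ : σ.PosSemidef) : (trOutA σ).PosSemidef := by
  have : trOutA σ = ∑ a, σ.submatrix (fun q => (a, q)) fun q => (a, q) := by
    ext a a'
    simp [trOutA, Matrix.sum_apply]
  rw [this]
  exact Matrix.posSemidef_sum _ fun q _ => hσ.submatrix _

lemma trace_trOutA {A Q : Type} [Fintype A] [Fintype Q] (σ : Matrix (A × Q) (A × Q) ℂ) :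
    (trOutA σ).trace = σ.trace := by
  simp [trOutA, Matrix.trace, Fintype.sum_prod_type_right]

lemma isDensity_trOutB {A Q : Type} [Fintype A] [DecidableEq A] [Fintype Q] [DecidableEq Q]
    {σ : Matrix (A × Q) (A × Q) ℂ} (hσ : IsDensity σ) : IsDensity (trOutB σ) :=
  ⟨trOutB_posSemidef hσ.1, by rw [trace_trOutB, hσ.2]⟩

lemma isDensity_trOutA {A Q : Type} [Fintype A] [DecidableEq A] [Fintype Q] [DecidableEq Q]
    {σ : Matrix (A × Q) (A × Q) ℂ} (hσ : IsDensity σ) : IsDensity (trOutA σ) :=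
  ⟨trOutA_posSemidef hσ.1, by rw [trace_trOutA, hσ.2]⟩

/-- A bipartite positive operator is dominated by `|Q|` times its marginal tensored with `1`. -/
lemma card_smul_trOutB_kronecker_one_sub_posSemidef {A Q : Type} [Fintype A] [DecidableEq A]
    [Fintype Q] [DecidableEq Q] {σ : Matrix (A × Q) (A × Q) ℂ} (hσ : σ.PosSemidef) :
    (((Fintype.card Q : ℝ) : ℂ) • (trOutB σ ⊗ₖ (1 : Matrix Q Q ℂ)) - σ).PosSemidef := by
  set N : Q → Q → Matrix (A × Q) (A × Q) ℂ := fun q r =>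
    (σ.submatrix (fun a => (a, r)) fun a => (a, r)) ⊗ₖ
      Matrix.diagonal (fun b => if b = q then 1 else 0) with hN
  set P : Q → Matrix (A × Q) (A × Q) ℂ := fun q =>
    Matrix.diagonal fun x => if x.2 = q then 1 else 0 with hP
  have key : ((Fintype.card Q : ℝ) : ℂ) • (trOutB σ ⊗ₖ (1 : Matrix Q Q ℂ)) - σ =
      ((Fintype.card Q : ℝ) : ℂ) • (∑ q, ∑ r, if q = r then 0 else N q r) +
      ((1 / 2 : ℝ) : ℂ) • ∑ q, ∑ r, (P q - P r) * σ * (P q - P r)ᴴ := by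
    have hP1 : ∀ q r, (P q - P r) * σ * (P q - P r)ᴴ =
        Matrix.of fun x y => ((if x.2 = q then 1 else 0) - (if x.2 = r then 1 else 0)) *
          ((if y.2 = q then 1 else 0) - (if y.2 = r then 1 else 0)) * σ x y := by
      intro q r
      ext x y
      rw [hP, Matrix.diagonal_sub, Matrix.diagonal_conjTranspose, Matrix.mul_diagonal,
        Matrix.diagonal_mul]
      have hst : ∀ (c : Prop) [Decidable c], star (if c then (1 : ℂ) else 0) = if c then 1 else 0 := by
        intro c _; split_ifs <;> simp
      simp only [Matrix.of_apply, Pi.star_apply, star_sub, hst]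
      ring
    simp only [hP1]
    ext ⟨a, b⟩ ⟨a', b'⟩
    have h1 : ∑ q, ∑ r, (((if b = q then (1 : ℂ) else 0) - (if b = r then 1 else 0)) *
          ((if b' = q then 1 else 0) - (if b' = r then 1 else 0)) * σ (a, b) (a', b')) =
          2 * ((if b = b' then (Fintype.card Q : ℂ) else 0) - 1) * σ (a, b) (a', b') := by
      simp only [← Finset.sum_mul]
      congr 1
      simp only [mul_sub, sub_mul, Finset.sum_sub_distrib, ite_mul, one_mul, zero_mul,
        Finset.sum_ite_eq, Finset.mem_univ, if_true, Finset.sum_const, Finset.card_univ,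
        nsmul_eq_mul, ← Finset.mul_sum, mul_one, eq_comm (a := b') (b := b)]
      have h4 : ∑ q, ∑ r, (if b = q then if b' = r then (1 : ℂ) else 0 else 0) = 1 := by
        rw [Finset.sum_comm]
        simp
      rw [h4]
      split_ifs <;> ring
    have h2 : (∑ q, ∑ r, if q = r then 0 else N q r) (a, b) (a', b') =
        if b = b' then ∑ r, σ (a, r) (a', r) - σ (a, b) (a', b) else 0 := by
      have h3 : ∀ q r, (if q = r then 0 else N q r) (a, b) (a', b') =
          if b = q then (if b = b' then σ (a, r) (a', r) - (if q = r then σ (a, r) (a', r) else 0)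
            else 0) else 0 := by
        intro q r
        have hNe : N q r (a, b) (a', b') =
            if b = q then (if b = b' then σ (a, r) (a', r) else 0) else 0 := by
          simp only [hN, Matrix.kroneckerMap_apply, Matrix.submatrix_apply, Matrix.diagonal_apply]
          split_ifs <;> simp
        by_cases hqr : q = r
        · simp [hqr]
        · simp [hqr, hNe]
      simp only [Matrix.sum_apply, h3]
      rw [Finset.sum_comm]
      simp only [Finset.sum_ite_eq, Finset.mem_univ, if_true]
      split_ifs
      · rw [Finset.sum_sub_distrib]
        simp
      · simp
    simp only [Matrix.sub_apply, Matrix.add_apply, Matrix.smul_apply, h2, Matrix.sum_apply,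
      Matrix.of_apply, h1, Matrix.kroneckerMap_apply, trOutB, Matrix.one_apply, smul_eq_mul]
    by_cases h : b = b'
    · subst h
      simp
      ring
    · simp [h]
  rw [key]
  refine Matrix.PosSemidef.add (Matrix.PosSemidef.smul ?_ (by positivity))
    (Matrix.PosSemidef.smul ?_ ?_)
  · refine Matrix.posSemidef_sum _ fun q _ => Matrix.posSemidef_sum _ fun r _ => ?_
    split_ifs
    · exact Matrix.PosSemidef.zero
    · refine (hσ.submatrix _).kronecker (Matrix.PosSemidef.diagonal fun b => ?_)
      dsimp only
      split_ifs <;> simp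
  · exact Matrix.posSemidef_sum _ fun q _ => Matrix.posSemidef_sum _ fun r _ =>
      hσ.mul_mul_conjTranspose_same _
  · rw [Complex.zero_le_real]; norm_num

/-- The completely mixed state. -/
lemma isDensity_maxMixed {Q : Type} [Fintype Q] [DecidableEq Q] {r : ℝ} (hr : 0 ≤ r)
    (h : r * Fintype.card Q = 1) : IsDensity ((r : ℂ) • (1 : Matrix Q Q ℂ)) := by
  refine ⟨Matrix.PosSemidef.one.smul (by simpa using hr), ?_⟩
  rw [Matrix.trace_smul, Matrix.trace_one, smul_eq_mul]
  exact_mod_cast h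

lemma IsDensity.kronecker {A B : Type} [Fintype A] [DecidableEq A] [Fintype B] [DecidableEq B]
    {α : Matrix A A ℂ} {β : Matrix B B ℂ} (hα : IsDensity α) (hβ : IsDensity β) :
    IsDensity (α ⊗ₖ β) :=
  ⟨hα.1.kronecker hβ.1, by rw [Matrix.trace_kronecker, hα.2, hβ.2, one_mul]⟩

lemma trOutA_eq_trOutB_submatrix {Q B : Type} [Fintype Q] [Fintype B]
    (σ : Matrix (Q × B) (Q × B) ℂ) :
    trOutA σ = trOutB (σ.submatrix Prod.swap Prod.swap) := by
  ext b b'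
  simp [trOutA, trOutB]

lemma four_smul_trOutB_posSemidef {A Q : Type} [Fintype A] [DecidableEq A]
    [Fintype Q] [DecidableEq Q] (hQ : Fintype.card Q = 2) {α : Matrix (A × Q) (A × Q) ℂ}
    (hα : α.PosSemidef) :
    ((4 : ℂ) • (trOutB α ⊗ₖ (((1 / 2 : ℝ) : ℂ) • (1 : Matrix Q Q ℂ))) - α).PosSemidef := by
  have h := card_smul_trOutB_kronecker_one_sub_posSemidef hα
  rw [hQ] at h
  convert h using 2
  rw [Matrix.kronecker_smul, smul_smul]
  norm_num

lemma four_smul_trOutA_posSemidef {Q B : Type} [Fintype B] [DecidableEq B]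
    [Fintype Q] [DecidableEq Q] (hQ : Fintype.card Q = 2) {β : Matrix (Q × B) (Q × B) ℂ}
    (hβ : β.PosSemidef) :
    ((4 : ℂ) • ((((1 / 2 : ℝ) : ℂ) • (1 : Matrix Q Q ℂ)) ⊗ₖ trOutA β) - β).PosSemidef := by
  have h := (four_smul_trOutB_posSemidef hQ (hβ.submatrix Prod.swap)).submatrix Prod.swap
  rw [← trOutA_eq_trOutB_submatrix] at h
  convert h using 1
  ext ⟨q, b⟩ ⟨q', b'⟩
  simp [Matrix.kroneckerMap_apply]
  ring

/-- A protocol with `l` communicated qubits acts as a positive trace-preserving map which sends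
product states to operators dominated by `4 ^ l` times a product state. -/
lemma Reach.exists_map {A B : Type} [Fintype A] [DecidableEq A] [Fintype B] [DecidableEq B]
    {ρ : Matrix (A × B) (A × B) ℂ} {l : ℕ}
    {A' B' : Type} [Fintype A'] [DecidableEq A'] [Fintype B'] [DecidableEq B']
    {ρ' : Matrix (A' × B') (A' × B') ℂ} (h : Reach A B ρ l A' B' ρ') :
    ∃ Λ : Matrix (A × B) (A × B) ℂ →ₗ[ℂ] Matrix (A' × B') (A' × B') ℂ,
      Λ ρ = ρ' ∧ (∀ X, X.PosSemidef → (Λ X).PosSemidef) ∧ (∀ X, (Λ X).trace = X.trace) ∧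
      ∀ (α : Matrix A A ℂ) (β : Matrix B B ℂ), IsDensity α → IsDensity β →
        ∃ (α' : Matrix A' A' ℂ) (β' : Matrix B' B' ℂ), IsDensity α' ∧ IsDensity β' ∧
          ((4 : ℂ) ^ l • (α' ⊗ₖ β') - Λ (α ⊗ₖ β)).PosSemidef := by
  induction h with
  | refl =>
    refine ⟨LinearMap.id, rfl, fun X hX => hX, fun X => rfl, fun α β hα hβ => ⟨α, β, hα, hβ, ?_⟩⟩
    simpa using Matrix.PosSemidef.zero
  | @localA l A₁ B₁ _ _ _ _ σ A₂ _ _ ι _ K hK _ ih =>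
    obtain ⟨Λ, hρ, hpos, htr, hprod⟩ := ih
    refine ⟨krausMap (fun i => K i ⊗ₖ (1 : Matrix B₁ B₁ ℂ)) ∘ₗ Λ, by simp [hρ, krausMap],
      fun X hX => krausMap_posSemidef _ (hpos X hX),
      fun X => (trace_krausMap (kronecker_one_kraus hK) _).trans (htr X), fun α β hα hβ => ?_⟩
    obtain ⟨α', β', hα', hβ', hle⟩ := hprod α β hα hβ
    refine ⟨krausMap K α', β', isDensity_krausMap hK hα', hβ', ?_⟩
    have := krausMap_posSemidef (fun i => K i ⊗ₖ (1 : Matrix B₁ B₁ ℂ)) hle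
    rwa [map_sub, map_smul, krausMap_kronecker_one] at this
  | @localB l A₁ B₁ _ _ _ _ σ B₂ _ _ ι _ K hK _ ih =>
    obtain ⟨Λ, hρ, hpos, htr, hprod⟩ := ih
    refine ⟨krausMap (fun i => (1 : Matrix A₁ A₁ ℂ) ⊗ₖ K i) ∘ₗ Λ, by simp [hρ, krausMap],
      fun X hX => krausMap_posSemidef _ (hpos X hX),
      fun X => (trace_krausMap (one_kronecker_kraus hK) _).trans (htr X), fun α β hα hβ => ?_⟩
    obtain ⟨α', β', hα', hβ', hle⟩ := hprod α β hα hβ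
    refine ⟨α', krausMap K β', hα', isDensity_krausMap hK hβ', ?_⟩
    have := krausMap_posSemidef (fun i => (1 : Matrix A₁ A₁ ℂ) ⊗ₖ K i) hle
    rwa [map_sub, map_smul, krausMap_one_kronecker] at this
  | @sendA l A₁ Q B₁ _ _ _ _ _ _ hQ σ _ ih =>
    obtain ⟨Λ, hρ, hpos, htr, hprod⟩ := ih
    refine ⟨(Matrix.reindexLinearEquiv ℂ ℂ (Equiv.prodAssoc A₁ Q B₁)
      (Equiv.prodAssoc A₁ Q B₁)).toLinearMap ∘ₗ Λ, by simp [hρ],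
      fun X hX => (hpos X hX).submatrix _,
      fun X => ?_, fun α β hα hβ => ?_⟩
    · rw [← htr X]
      exact Equiv.sum_comp (Equiv.prodAssoc A₁ Q B₁).symm fun i => Λ X i i
    obtain ⟨α', β', hα', hβ', hle⟩ := hprod α β hα hβ
    refine ⟨trOutB α', (((1 / 2 : ℝ) : ℂ) • 1) ⊗ₖ β', isDensity_trOutB hα',
      (isDensity_maxMixed (by norm_num) (by rw [hQ]; norm_num)).kronecker hβ', ?_⟩
    have h1 := (((four_smul_trOutB_posSemidef hQ hα'.1).kronecker hβ'.1).smul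
      (show (0 : ℂ) ≤ 4 ^ l by positivity)).add hle
    refine (congrArg Matrix.PosSemidef ?_).mpr (h1.submatrix (Equiv.prodAssoc A₁ Q B₁).symm)
    ext ⟨a, q, b⟩ ⟨a', q', b'⟩
    simp [Matrix.kroneckerMap_apply]
    ring
  | @sendB l A₁ Q B₁ _ _ _ _ _ _ hQ σ _ ih =>
    obtain ⟨Λ, hρ, hpos, htr, hprod⟩ := ih
    refine ⟨(Matrix.reindexLinearEquiv ℂ ℂ (Equiv.prodAssoc A₁ Q B₁).symm
      (Equiv.prodAssoc A₁ Q B₁).symm).toLinearMap ∘ₗ Λ, by simp [hρ],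
      fun X hX => (hpos X hX).submatrix _,
      fun X => ?_, fun α β hα hβ => ?_⟩
    · rw [← htr X]
      exact Equiv.sum_comp (Equiv.prodAssoc A₁ Q B₁) fun i => Λ X i i
    obtain ⟨α', β', hα', hβ', hle⟩ := hprod α β hα hβ
    refine ⟨α' ⊗ₖ (((1 / 2 : ℝ) : ℂ) • 1), trOutA β',
      hα'.kronecker (isDensity_maxMixed (by norm_num) (by rw [hQ]; norm_num)),
      isDensity_trOutA hβ', ?_⟩
    have h1 := ((hα'.1.kronecker (four_smul_trOutA_posSemidef hQ hβ'.1)).smul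
      (show (0 : ℂ) ≤ 4 ^ l by positivity)).add hle
    refine (congrArg Matrix.PosSemidef ?_).mpr (h1.submatrix (Equiv.prodAssoc A₁ Q B₁))
    ext ⟨⟨a, q⟩, b⟩ ⟨⟨a', q'⟩, b'⟩
    simp [Matrix.kroneckerMap_apply]
    ring

/-- The vector of cubic phases labelled by `θ`. -/
def phaseVec {n : Type} (θ : n → ZMod 3) : n → ℂ := fun i => ZMod.stdAddChar (θ i)

lemma star_stdAddChar (x : ZMod 3) :
    star (ZMod.stdAddChar x : ℂ) = ZMod.stdAddChar (-x) :=
  (AddChar.map_neg_eq_conj _ x).symm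

/-- The fourth moments of uniformly random cubic phases. -/
lemma sum_phaseVec {n : Type} [Fintype n] [DecidableEq n] (i i' m m' : n) :
    ∑ θ : n → ZMod 3, phaseVec θ i * star (phaseVec θ i') * (phaseVec θ m * star (phaseVec θ m')) =
      if i = i' ∧ m = m' ∨ i = m' ∧ m = i' then (3 : ℂ) ^ Fintype.card n else 0 := by
  set f : (n → ZMod 3) →+ ZMod 3 :=
    Pi.evalAddMonoidHom (fun _ : n => ZMod 3) i - Pi.evalAddMonoidHom (fun _ : n => ZMod 3) i' +
      (Pi.evalAddMonoidHom (fun _ : n => ZMod 3) m - Pi.evalAddMonoidHom (fun _ : n => ZMod 3) m') with hf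
  have h1 : ∀ θ : n → ZMod 3,
      phaseVec θ i * star (phaseVec θ i') * (phaseVec θ m * star (phaseVec θ m')) =
        (ZMod.stdAddChar.compAddMonoidHom f : AddChar (n → ZMod 3) ℂ) θ := by
    intro θ
    simp only [phaseVec, star_stdAddChar, ← AddChar.map_add_eq_mul, AddChar.compAddMonoidHom_apply]
    simp [hf, sub_eq_add_neg]
  have h2 : (ZMod.stdAddChar.compAddMonoidHom f : AddChar (n → ZMod 3) ℂ) = 0 ↔
      (i = i' ∧ m = m' ∨ i = m' ∧ m = i') := by
    constructor
    · intro h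
      have h3 : ∀ θ : n → ZMod 3, θ i - θ i' + (θ m - θ m') = 0 := fun θ => by
        refine ZMod.injective_stdAddChar ?_
        simpa [hf] using DFunLike.congr_fun h θ
      have hi := h3 (Pi.single i 1)
      have hm := h3 (Pi.single m 1)
      simp only [Pi.single_apply] at hi hm
      split_ifs at hi hm <;>
        first
          | exact absurd hi (by decide)
          | exact absurd hm (by decide)
          | grind
    · rintro (⟨rfl, rfl⟩ | ⟨rfl, rfl⟩) <;> ext θ <;> simp [hf]
  simp only [h1, AddChar.sum_eq_ite, h2]
  simp

/-- Index set of the design: phase vectors together with the standard basis. -/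
abbrev DesignIdx (n : Type) : Type := (n → ZMod 3) ⊕ n

/-- The elements of a measurement with informationally complete statistics. -/
def designPOVM (n : Type) [Fintype n] [DecidableEq n] : DesignIdx n → Matrix n n ℂ
  | .inl θ => ((Fintype.card n / ((Fintype.card n + 1) * 3 ^ Fintype.card n) : ℝ) : ℂ) •
      outer (phaseVec θ)
  | .inr i => ((1 / (Fintype.card n + 1) : ℝ) : ℂ) • outer (Pi.single i 1)

/-- The operators reconstructing a state from the statistics of `designPOVM`. -/
def designDual (n : Type) [Fintype n] [DecidableEq n] : DesignIdx n → Matrix n n ℂ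
  | .inl θ => (((Fintype.card n + 1) / Fintype.card n : ℝ) : ℂ) • outer (phaseVec θ)
  | .inr i => ((Fintype.card n + 1 : ℝ) : ℂ) • outer (Pi.single i 1)

lemma outer_posSemidef {n : Type} [Fintype n] (v : n → ℂ) : (outer v).PosSemidef :=
  Matrix.posSemidef_vecMulVec_self_star v

lemma designPOVM_posSemidef {n : Type} [Fintype n] [DecidableEq n] (j : DesignIdx n) :
    (designPOVM n j).PosSemidef := by
  rcases j with θ | i
  · exact (outer_posSemidef _).smul (Complex.zero_le_real.2 (by positivity))
  · exact (outer_posSemidef _).smul (Complex.zero_le_real.2 (by positivity))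

lemma designDual_posSemidef {n : Type} [Fintype n] [DecidableEq n] (j : DesignIdx n) :
    (designDual n j).PosSemidef := by
  rcases j with θ | i
  · exact (outer_posSemidef _).smul (Complex.zero_le_real.2 (by positivity))
  · exact (outer_posSemidef _).smul (Complex.zero_le_real.2 (by positivity))

lemma trace_designDual {n : Type} [Fintype n] [DecidableEq n] [Nonempty n] (j : DesignIdx n) :
    (designDual n j).trace = Fintype.card n + 1 := by
  have hc : (Fintype.card n : ℂ) ≠ 0 := Nat.cast_ne_zero.2 Fintype.card_ne_zero
  rcases j with θ | i
  · have : (outer (phaseVec θ)).trace = Fintype.card n := by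
      simp only [Matrix.trace, outer, phaseVec, Matrix.diag_apply, Matrix.of_apply,
        star_stdAddChar, ← AddChar.map_add_eq_mul]
      simp
    simp only [designDual, Matrix.trace_smul, this]
    push_cast
    rw [smul_eq_mul, div_mul_cancel₀ _ hc]
  · have : (outer (Pi.single i (1 : ℂ))).trace = 1 := by
      simp [Matrix.trace, outer, Pi.single_apply]
    simp only [designDual, Matrix.trace_smul, this]
    simp

lemma sum_designPOVM_mul_designDual {n : Type} [Fintype n] [DecidableEq n] [Nonempty n]
    (i i' m m' : n) :
    ∑ j, designPOVM n j i i' * designDual n j m m' =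
      (if i = i' then 1 else 0) * (if m = m' then 1 else 0) +
        (if i = m' then 1 else 0) * (if m = i' then 1 else 0) := by
  have hc : (Fintype.card n : ℂ) ≠ 0 := Nat.cast_ne_zero.2 Fintype.card_ne_zero
  have hc' : (Fintype.card n + 1 : ℂ) ≠ 0 := Nat.cast_add_one_ne_zero _
  have h1 : ∀ θ : n → ZMod 3, designPOVM n (.inl θ) i i' * designDual n (.inl θ) m m' =
      (3 ^ Fintype.card n)⁻¹ *
        (phaseVec θ i * star (phaseVec θ i') * (phaseVec θ m * star (phaseVec θ m'))) := by
    intro θ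
    simp only [designPOVM, designDual, outer, Matrix.smul_apply, Matrix.of_apply, smul_eq_mul]
    push_cast
    field_simp
  have h2 : ∀ k : n, designPOVM n (.inr k) i i' * designDual n (.inr k) m m' =
      if k = i then (if i = i' ∧ i = m ∧ i = m' then 1 else 0) else 0 := by
    intro k
    simp only [designPOVM, designDual, outer, Matrix.smul_apply, Matrix.of_apply, smul_eq_mul,
      Pi.single_apply]
    push_cast
    by_cases e : k = i
    · subst e
      by_cases e1 : k = i' <;> by_cases e2 : k = m <;> by_cases e3 : k = m' <;>
        simp_all [eq_comm]
    · simp [e, Ne.symm e]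
  rw [Fintype.sum_sum_type]
  simp only [h1, h2, ← Finset.mul_sum, sum_phaseVec, Finset.sum_ite_eq', Finset.mem_univ, if_true]
  by_cases e1 : i = i' <;> by_cases e2 : m = m' <;> by_cases e3 : i = m' <;>
    by_cases e4 : m = i' <;> by_cases e5 : i = m <;> simp_all [eq_comm]

lemma sum_trace_designPOVM_smul {n : Type} [Fintype n] [DecidableEq n] [Nonempty n]
    (X : Matrix n n ℂ) :
    ∑ j, (designPOVM n j * X).trace • designDual n j = X + X.trace • 1 := by
  ext m m'
  have h1 : ∀ j, (designPOVM n j * X).trace * designDual n j m m' =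
      ∑ i, ∑ i', X i' i * (designPOVM n j i i' * designDual n j m m') := by
    intro j
    simp only [Matrix.trace, Matrix.diag_apply, Matrix.mul_apply, Finset.sum_mul]
    exact Finset.sum_congr rfl fun i _ => Finset.sum_congr rfl fun i' _ => by ring
  simp only [Matrix.sum_apply, Matrix.smul_apply, smul_eq_mul, h1, Matrix.add_apply]
  rw [Finset.sum_comm]
  have h2 : ∀ i, ∑ j, ∑ i', X i' i * (designPOVM n j i i' * designDual n j m m') =
      ∑ i', X i' i * ((if i = i' then 1 else 0) * (if m = m' then 1 else 0) +
        (if i = m' then 1 else 0) * (if m = i' then 1 else 0)) := by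
    intro i
    rw [Finset.sum_comm]
    simp only [← Finset.mul_sum, sum_designPOVM_mul_designDual]
  simp only [h2, mul_add, Finset.sum_add_distrib]
  rw [add_comm]
  congr 1
  · simp
  · by_cases e : m = m' <;> simp [Matrix.trace, Matrix.one_apply, e]

lemma isPOVM_designPOVM (n : Type) [Fintype n] [DecidableEq n] [Nonempty n] :
    IsPOVM (designPOVM n) := by
  refine ⟨designPOVM_posSemidef, ?_⟩
  have hc' : (Fintype.card n + 1 : ℂ) ≠ 0 := Nat.cast_add_one_ne_zero _
  ext i i'
  have h1 : ∑ m, ∑ j, designPOVM n j i i' * designDual n j m m =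
      (Fintype.card n + 1) * ∑ j, designPOVM n j i i' := by
    rw [Finset.sum_comm, Finset.mul_sum]
    refine Finset.sum_congr rfl fun j _ => ?_
    rw [← Finset.mul_sum, ← trace_designDual j, mul_comm]
    rfl
  simp only [sum_designPOVM_mul_designDual] at h1
  rw [Matrix.sum_apply, ← mul_right_inj' hc', ← h1, Matrix.one_apply]
  by_cases e : i = i' <;> simp [e, Finset.sum_add_distrib]

/-- Reconstruction of an operator with vanishing partial traces from its local statistics. -/
lemma sum_trace_smul_designDual_kronecker {n : Type} [Fintype n] [DecidableEq n] [Nonempty n]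
    {X : Matrix (n × n) (n × n) ℂ} (hA : trOutA X = 0) (hB : trOutB X = 0) :
    ∑ x : DesignIdx n × DesignIdx n, ((designPOVM n x.1 ⊗ₖ designPOVM n x.2) * X).trace •
      (designDual n x.1 ⊗ₖ designDual n x.2) = X := by
  set Z : n → n → Matrix n n ℂ := fun a a' => Matrix.of fun b b' => X (a, b) (a', b') with hZ
  set Y : DesignIdx n → Matrix n n ℂ := fun k => Matrix.of fun a a' =>
    (designPOVM n k * Z a a').trace with hY
  have h1 : ∀ j k, ((designPOVM n j ⊗ₖ designPOVM n k) * X).trace =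
      (designPOVM n j * Y k).trace := by
    intro j k
    simp only [hY, hZ, Matrix.trace, Matrix.diag_apply, Matrix.mul_apply, Matrix.of_apply,
      Fintype.sum_prod_type, Matrix.kroneckerMap_apply, Finset.mul_sum]
    refine Finset.sum_congr rfl fun a _ => ?_
    rw [Finset.sum_comm]
    refine Finset.sum_congr rfl fun a' _ => Finset.sum_congr rfl fun b _ =>
      Finset.sum_congr rfl fun b' _ => by ring
  have h2 : ∀ k, (Y k).trace = 0 := by
    intro k
    have : (Y k).trace = (designPOVM n k * trOutA X).trace := by
      have : trOutA X = ∑ a, Z a a := by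
        ext b b'
        simp [trOutA, hZ, Matrix.sum_apply]
      rw [this, Matrix.mul_sum, Matrix.trace_sum]
      rfl
    rw [this, hA, Matrix.mul_zero, Matrix.trace_zero]
  have h3 : ∀ k, ∑ j, (designPOVM n j * Y k).trace • designDual n j = Y k := by
    intro k
    rw [sum_trace_designPOVM_smul, h2, zero_smul, add_zero]
  have h4 : ∀ a a', (Z a a').trace = 0 := by
    intro a a'
    exact congrFun (congrFun hB a) a'
  rw [Fintype.sum_prod_type_right]
  simp only [h1, ← Matrix.smul_kronecker, ← kronecker_sum_left, h3]
  ext ⟨a, b⟩ ⟨a', b'⟩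
  have h5 := congrFun (congrFun (sum_trace_designPOVM_smul (Z a a')) b) b'
  rw [h4, zero_smul, add_zero, Matrix.sum_apply] at h5
  rw [Matrix.sum_apply]
  exact h5

lemma isProb_margA {α β : Type} [Fintype α] [Fintype β] {p : α × β → ℝ} (hp : IsProb p) :
    IsProb (margA p) :=
  ⟨fun _ => Finset.sum_nonneg fun _ _ => hp.1 _, by rw [← hp.2, Fintype.sum_prod_type]; rfl⟩

lemma isProb_margB {α β : Type} [Fintype α] [Fintype β] {p : α × β → ℝ} (hp : IsProb p) :
    IsProb (margB p) :=
  ⟨fun _ => Finset.sum_nonneg fun _ _ => hp.1 _, by rw [← hp.2, Fintype.sum_prod_type_right]; rfl⟩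

lemma IsProb.prod {α β : Type} [Fintype α] [Fintype β] {a : α → ℝ} {b : β → ℝ} (ha : IsProb a)
    (hb : IsProb b) : IsProb fun x : α × β => a x.1 * b x.2 :=
  ⟨fun _ => mul_nonneg (ha.1 _) (hb.1 _), by
    rw [Fintype.sum_prod_type, ← Finset.sum_mul_sum, ha.2, hb.2, one_mul]⟩

/-- Pinsker's inequality for the mutual information. -/
lemma sq_l1_marg_le {α β : Type} [Fintype α] [Fintype β] {p : α × β → ℝ} (hp : IsProb p) :
    l1 p (fun x => margA p x.1 * margB p x.2) ^ 2 ≤ 2 * (mi p * Real.log 2) := by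
  have hA : ∀ x, 0 < p x → 0 < margA p x.1 := fun x hx =>
    hx.trans_le (Finset.single_le_sum (f := fun b => p (x.1, b)) (fun _ _ => hp.1 _)
      (Finset.mem_univ x.2))
  have hB : ∀ x, 0 < p x → 0 < margB p x.2 := fun x hx =>
    hx.trans_le (Finset.single_le_sum (f := fun a => p (a, x.2)) (fun _ _ => hp.1 _)
      (Finset.mem_univ x.1))
  refine (sq_l1_le hp ((isProb_margA hp).prod (isProb_margB hp)) fun x hx =>
    mul_pos (hA x hx) (hB x hx)).trans_eq ?_
  rw [mi_mul_log_two]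
  congr 1
  refine Finset.sum_congr rfl fun x _ => ?_
  rcases (hp.1 x).eq_or_lt with h | h
  · simp [← h]
  · rw [Real.log_mul (hA x h).ne' (hB x h).ne']
    ring

lemma mi_nonneg {α β : Type} [Fintype α] [Fintype β] {p : α × β → ℝ} (hp : IsProb p) :
    0 ≤ mi p := by
  have h := (sq_nonneg _).trans (sq_l1_marg_le hp)
  have h2 : 0 < Real.log 2 := Real.log_pos (by norm_num)
  exact nonneg_of_mul_nonneg_left (by linarith) h2

lemma two_mul_sum_max_sub {α : Type} [Fintype α] {p q : α → ℝ} (hp : IsProb p) (hq : IsProb q) :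
    2 * ∑ x, max (p x - q x) 0 = l1 p q := by
  have h : ∀ x, 2 * max (p x - q x) 0 = |p x - q x| + (p x - q x) := fun x => by
    rcases le_total 0 (p x - q x) with h | h
    · rw [max_eq_left h, abs_of_nonneg h]; ring
    · rw [max_eq_right h, abs_of_nonpos h]; ring
  rw [Finset.mul_sum]
  simp only [h, Finset.sum_add_distrib, Finset.sum_sub_distrib, hp.2, hq.2, l1]
  ring

lemma margA_outcomeProb {A B J K : Type} [Fintype A] [DecidableEq A] [Fintype B] [DecidableEq B]
    [Fintype J] [Fintype K] (X : Matrix (A × B) (A × B) ℂ) (MA : J → Matrix A A ℂ)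
    {MB : K → Matrix B B ℂ} (hB : IsPOVM MB) :
    margA (outcomeProb X MA MB) = povmProb (trOutB X) MA := by
  ext j
  simp only [margA, outcomeProb, povmProb]
  rw [← Complex.re_sum, ← Matrix.trace_sum, ← Matrix.sum_mul, ← kronecker_sum_right, hB.2]
  congr 1
  simp only [Matrix.trace, Matrix.diag_apply, Matrix.mul_apply, Fintype.sum_prod_type,
    Matrix.kroneckerMap_apply, Matrix.one_apply, trOutB, Matrix.of_apply, Finset.mul_sum]
  refine Finset.sum_congr rfl fun a _ => ?_
  rw [Finset.sum_comm]
  simp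

lemma margB_outcomeProb {A B J K : Type} [Fintype A] [DecidableEq A] [Fintype B] [DecidableEq B]
    [Fintype J] [Fintype K] (X : Matrix (A × B) (A × B) ℂ) {MA : J → Matrix A A ℂ}
    (MB : K → Matrix B B ℂ) (hA : IsPOVM MA) :
    margB (outcomeProb X MA MB) = povmProb (trOutA X) MB := by
  ext j
  simp only [margB, outcomeProb, povmProb]
  rw [← Complex.re_sum, ← Matrix.trace_sum, ← Matrix.sum_mul, ← kronecker_sum_left, hA.2]
  congr 1
  simp only [Matrix.trace, Matrix.diag_apply, Matrix.mul_apply, Fintype.sum_prod_type,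
    Matrix.kroneckerMap_apply, Matrix.one_apply, trOutA, Matrix.of_apply, Finset.mul_sum]
  simp only [ite_mul, one_mul, zero_mul, Finset.sum_ite_irrel, Finset.sum_const_zero,
    Finset.sum_ite_eq, Finset.mem_univ, if_true]
  rw [Finset.sum_comm]
  exact Finset.sum_congr rfl fun _ _ => Finset.sum_comm

lemma outcomeProb_mono {A B J K : Type} [Fintype A] [DecidableEq A] [Fintype B] [DecidableEq B]
    [Fintype J] [Fintype K] {X Y : Matrix (A × B) (A × B) ℂ} (h : (Y - X).PosSemidef)
    {MA : J → Matrix A A ℂ} {MB : K → Matrix B B ℂ} (hA : IsPOVM MA) (hB : IsPOVM MB)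
    (x : J × K) : outcomeProb X MA MB x ≤ outcomeProb Y MA MB x := by
  have := outcomeProb_nonneg h hA hB x
  rw [outcomeProb_sub] at this
  linarith

lemma trOutB_kronecker {A B : Type} [Fintype A] [Fintype B] (α : Matrix A A ℂ)
    (β : Matrix B B ℂ) : trOutB (α ⊗ₖ β) = β.trace • α := by
  ext a a'
  simp [trOutB, Matrix.trace, ← Finset.mul_sum, mul_comm]

lemma trOutA_kronecker {A B : Type} [Fintype A] [Fintype B] (α : Matrix A A ℂ)
    (β : Matrix B B ℂ) : trOutA (α ⊗ₖ β) = α.trace • β := by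
  ext a a'
  simp [trOutA, Matrix.trace, Finset.sum_mul]

/-- The excess of a state over the product of its marginals is dominated by a positive operator
whose trace is controlled by the classical correlations of the design measurement. -/
lemma exists_posSemidef_product_add {n : Type} [Fintype n] [DecidableEq n] [Nonempty n]
    {ρ : Matrix (n × n) (n × n) ℂ} (hρ : IsDensity ρ) :
    ∃ N : Matrix (n × n) (n × n) ℂ, N.PosSemidef ∧
      (trOutB ρ ⊗ₖ trOutA ρ + N - ρ).PosSemidef ∧
      N.trace.re ≤ ((Fintype.card n : ℝ) + 1) ^ 2 * (Real.sqrt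
        (2 * mi (outcomeProb ρ (designPOVM n) (designPOVM n)) * Real.log 2) / 2) := by
  set τ := trOutB ρ ⊗ₖ trOutA ρ with hτ
  have hτd : IsDensity τ := (isDensity_trOutB hρ).kronecker (isDensity_trOutA hρ)
  have hE := isPOVM_designPOVM n
  set p := outcomeProb ρ (designPOVM n) (designPOVM n) with hp
  set q := outcomeProb τ (designPOVM n) (designPOVM n) with hq
  have hpP : IsProb p := isProb_outcomeProb hρ hE hE
  have hqP : IsProb q := isProb_outcomeProb hτd hE hE
  have hpq : (fun x => margA p x.1 * margB p x.2) = q := by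
    ext x
    rw [hp, margA_outcomeProb _ _ hE, margB_outcomeProb _ _ hE, hq, hτ,
      outcomeProb_kronecker (isDensity_trOutB hρ).1 _ hE]
  set F : DesignIdx n × DesignIdx n → Matrix (n × n) (n × n) ℂ :=
    fun x => designDual n x.1 ⊗ₖ designDual n x.2 with hF
  have hFp : ∀ x, (F x).PosSemidef := fun x =>
    (designDual_posSemidef x.1).kronecker (designDual_posSemidef x.2)
  have hreal : ∀ X : Matrix (n × n) (n × n) ℂ, X.PosSemidef → ∀ x,
      ((designPOVM n x.1 ⊗ₖ designPOVM n x.2) * X).trace =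
        ((outcomeProb X (designPOVM n) (designPOVM n) x : ℝ) : ℂ) := fun X hX x =>
    Complex.eq_re_of_ofReal_le
      (trace_mul_nonneg ((hE.1 x.1).kronecker (hE.1 x.2)) hX)
  have hrec : ρ - τ = ∑ x, ((p x - q x : ℝ) : ℂ) • F x := by
    rw [← sum_trace_smul_designDual_kronecker (X := ρ - τ)]
    · refine Finset.sum_congr rfl fun x _ => ?_
      rw [Matrix.mul_sub, Matrix.trace_sub, hreal ρ hρ.1, hreal τ hτd.1, Complex.ofReal_sub]
    · have : trOutA (ρ - τ) = trOutA ρ - trOutA τ := by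
        ext; simp [trOutA]
      rw [this, hτ, trOutA_kronecker, (isDensity_trOutB hρ).2, one_smul, sub_self]
    · have : trOutB (ρ - τ) = trOutB ρ - trOutB τ := by
        ext; simp [trOutB]
      rw [this, hτ, trOutB_kronecker, (isDensity_trOutA hρ).2, one_smul, sub_self]
  refine ⟨∑ x, ((max (p x - q x) 0 : ℝ) : ℂ) • F x, ?_, ?_, ?_⟩
  · exact Matrix.posSemidef_sum _ fun x _ =>
      (hFp x).smul (Complex.zero_le_real.2 (le_max_right _ _))
  · have : τ + ∑ x, ((max (p x - q x) 0 : ℝ) : ℂ) • F x - ρ =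
        ∑ x, ((max (p x - q x) 0 - (p x - q x) : ℝ) : ℂ) • F x := by
      simp only [Complex.ofReal_sub (max _ _), sub_smul, Finset.sum_sub_distrib, ← hrec]
      abel
    rw [this]
    exact Matrix.posSemidef_sum _ fun x _ =>
      (hFp x).smul (Complex.zero_le_real.2 (sub_nonneg.2 (le_max_left _ _)))
  · have htr : (∑ x, ((max (p x - q x) 0 : ℝ) : ℂ) • F x).trace.re =
        ((Fintype.card n : ℝ) + 1) ^ 2 * ∑ x, max (p x - q x) 0 := by
      have h1 : ∀ x, (((max (p x - q x) 0 : ℝ) : ℂ) • F x).trace =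
          ((((Fintype.card n : ℝ) + 1) ^ 2 * max (p x - q x) 0 : ℝ) : ℂ) := fun x => by
        rw [Matrix.trace_smul, hF, Matrix.trace_kronecker, trace_designDual, trace_designDual]
        push_cast
        rw [smul_eq_mul]
        ring
      rw [Matrix.trace_sum]
      simp only [h1]
      rw [← Complex.ofReal_sum, Complex.ofReal_re, Finset.mul_sum]
    rw [htr]
    have h2 := two_mul_sum_max_sub hpP hqP
    have h3 := sq_l1_marg_le hpP
    rw [hpq, ← mul_assoc] at h3
    have h4 := Real.le_sqrt_of_sq_le h3
    gcongr
    linarith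

/-- Comparison of the final statistics `p` with the statistics `q`, `u` obtained when the protocol
is run on the product of the marginals, respectively on Alice's marginal and white noise. -/
lemma Reach.exists_compare {A B : Type} [Fintype A] [DecidableEq A] [Fintype B] [DecidableEq B]
    [Nonempty B] {ρ : Matrix (A × B) (A × B) ℂ} (hρ : IsDensity ρ) {l : ℕ}
    {A' B' : Type} [Fintype A'] [DecidableEq A'] [Fintype B'] [DecidableEq B']
    {ρ' : Matrix (A' × B') (A' × B') ℂ} (h : Reach A B ρ l A' B' ρ')
    {J K : Type} [Fintype J] [Fintype K] {MA : J → Matrix A' A' ℂ} {MB : K → Matrix B' B' ℂ}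
    (hA : IsPOVM MA) (hB : IsPOVM MB) :
    IsProb (outcomeProb ρ' MA MB) ∧ ∃ q u : J × K → ℝ,
      (∀ x, 0 ≤ q x) ∧ (∀ x, 0 ≤ u x) ∧
      (∀ x, outcomeProb ρ' MA MB x ≤ (Fintype.card B : ℝ) ^ 2 * u x) ∧
      (∀ N : Matrix (A × B) (A × B) ℂ, N.PosSemidef →
        (trOutB ρ ⊗ₖ trOutA ρ + N - ρ).PosSemidef →
        ∑ x, max (outcomeProb ρ' MA MB x - q x) 0 ≤ N.trace.re) ∧
      ∀ s : ℝ, 0 ≤ s → s ≤ 1 → ∃ (a : J → ℝ) (b : K → ℝ), IsProb a ∧ IsProb b ∧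
        ∀ x, (1 - s) * q x + s * u x ≤ 4 ^ l * (a x.1 * b x.2) := by
  obtain ⟨Λ, rfl, hpos, htr, hprod⟩ := h.exists_map
  have hcard : (0 : ℝ) < Fintype.card B := Nat.cast_pos.2 Fintype.card_pos
  have hα := isDensity_trOutB hρ
  have hβ := isDensity_trOutA hρ
  have hω : IsDensity (((1 / Fintype.card B : ℝ) : ℂ) • (1 : Matrix B B ℂ)) :=
    isDensity_maxMixed (by positivity) (by field_simp)
  set α := trOutB ρ with hαdef
  set β := trOutA ρ with hβdef
  set ω := ((1 / Fintype.card B : ℝ) : ℂ) • (1 : Matrix B B ℂ) with hωdef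
  refine ⟨isProb_outcomeProb ⟨hpos _ hρ.1, by rw [htr, hρ.2]⟩ hA hB,
    outcomeProb (Λ (α ⊗ₖ β)) MA MB, outcomeProb (Λ (α ⊗ₖ ω)) MA MB,
    outcomeProb_nonneg (hpos _ (hα.kronecker hβ).1) hA hB,
    outcomeProb_nonneg (hpos _ (hα.kronecker hω).1) hA hB, fun x => ?_, fun N hN hle => ?_,
    fun s hs0 hs1 => ?_⟩
  · rw [← outcomeProb_smul]
    refine outcomeProb_mono ?_ hA hB x
    rw [← map_smul, ← map_sub]
    refine hpos _ ?_
    convert card_smul_trOutB_kronecker_one_sub_posSemidef hρ.1 using 2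
    rw [hωdef, Matrix.kronecker_smul, smul_smul, ← Complex.ofReal_mul]
    congr 2
    field_simp
  · have h1 : ∀ x, max (outcomeProb (Λ ρ) MA MB x - outcomeProb (Λ (α ⊗ₖ β)) MA MB x) 0 ≤
        outcomeProb (Λ N) MA MB x := fun x => by
      have h2 := outcomeProb_nonneg (hpos _ hle) hA hB x
      rw [map_sub, map_add, outcomeProb_sub, outcomeProb_add] at h2
      exact max_le (by linarith) (outcomeProb_nonneg (hpos _ hN) hA hB x)
    exact (Finset.sum_le_sum fun x _ => h1 x).trans_eq (by rw [sum_outcomeProb _ hA hB, htr])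
  · have hσ : IsDensity (((1 - s : ℝ) : ℂ) • β + (s : ℂ) • ω) := by
      refine ⟨(hβ.1.smul (Complex.zero_le_real.2 (by linarith))).add
        (hω.1.smul (Complex.zero_le_real.2 hs0)), ?_⟩
      rw [Matrix.trace_add, Matrix.trace_smul, Matrix.trace_smul, hβ.2, hω.2]
      simp
    obtain ⟨α', β', hα', hβ', hle⟩ := hprod α _ hα hσ
    refine ⟨povmProb α' MA, povmProb β' MB, isProb_povmProb hα' hA, isProb_povmProb hβ' hB,
      fun x => ?_⟩
    have h1 := outcomeProb_mono hle hA hB x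
    have h2 : ((4 : ℂ) ^ l) = ((4 ^ l : ℝ) : ℂ) := by push_cast; rfl
    rw [h2, outcomeProb_smul, outcomeProb_kronecker hα'.1 _ hA, Matrix.kronecker_add,
      Matrix.kronecker_smul, Matrix.kronecker_smul, map_add, map_smul, map_smul,
      outcomeProb_add, outcomeProb_smul, outcomeProb_smul] at h1
    exact h1

/-- A state generated with `l` qubits of communication from a bipartite system with Bob's
dimension `|B|` has mutual information at most `2 l + 2 log |B|`. -/
lemma Reach.mi_mul_log_two_le {A B : Type} [Fintype A] [DecidableEq A] [Fintype B] [DecidableEq B]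
    [Nonempty B] {ρ : Matrix (A × B) (A × B) ℂ} (hρ : IsDensity ρ) {l : ℕ}
    {A' B' : Type} [Fintype A'] [DecidableEq A'] [Fintype B'] [DecidableEq B']
    {ρ' : Matrix (A' × B') (A' × B') ℂ} (h : Reach A B ρ l A' B' ρ')
    {J K : Type} [Fintype J] [Fintype K] {MA : J → Matrix A' A' ℂ} {MB : K → Matrix B' B' ℂ}
    (hA : IsPOVM MA) (hB : IsPOVM MB) :
    mi (outcomeProb ρ' MA MB) * Real.log 2 ≤
      2 * l * Real.log 2 + 2 * Real.log (Fintype.card B) := by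
  obtain ⟨hp, q, u, -, -, hpu, -, hmix⟩ := h.exists_compare hρ hA hB
  obtain ⟨a, b, ha, hb, hab⟩ := hmix 1 zero_le_one le_rfl
  have hcard : (0 : ℝ) < Fintype.card B := Nat.cast_pos.2 Fintype.card_pos
  have h1 : ∀ x, outcomeProb ρ' MA MB x ≤
      ((Fintype.card B : ℝ) ^ 2 * 4 ^ l) * (a x.1 * b x.2) := fun x => by
    have := hab x
    rw [mul_assoc]
    refine (hpu x).trans (mul_le_mul_of_nonneg_left ?_ (by positivity))
    linarith
  refine (_root_.mi_mul_log_two_le hp ha hb fun x hx =>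
    pos_of_mul_pos_right (hx.trans_le (h1 x)) (by positivity)).trans
    ((sum_mul_log_sub_log_le hp (by positivity) h1).trans_eq ?_)
  rw [Real.log_mul (by positivity) (by positivity), Real.log_pow, Real.log_pow,
    show (4 : ℝ) = 2 ^ 2 by norm_num, Real.log_pow]
  push_cast
  ring

/-- If the initial state is a product state, at most `2 l` bits of mutual information arise. -/
lemma Reach.mi_mul_log_two_le_of_product {A B : Type} [Fintype A] [DecidableEq A] [Fintype B]
    [DecidableEq B] [Nonempty B] {ρ : Matrix (A × B) (A × B) ℂ} (hρ : IsDensity ρ) {l : ℕ}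
    {A' B' : Type} [Fintype A'] [DecidableEq A'] [Fintype B'] [DecidableEq B']
    {ρ' : Matrix (A' × B') (A' × B') ℂ} (h : Reach A B ρ l A' B' ρ')
    {J K : Type} [Fintype J] [Fintype K] {MA : J → Matrix A' A' ℂ} {MB : K → Matrix B' B' ℂ}
    (hA : IsPOVM MA) (hB : IsPOVM MB) {N : Matrix (A × B) (A × B) ℂ} (hN : N.PosSemidef)
    (hle : (trOutB ρ ⊗ₖ trOutA ρ + N - ρ).PosSemidef) (htr : N.trace.re ≤ 0) :
    mi (outcomeProb ρ' MA MB) * Real.log 2 ≤ 2 * l * Real.log 2 := by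
  obtain ⟨hp, q, u, -, -, -, hpq, hmix⟩ := h.exists_compare hρ hA hB
  obtain ⟨a, b, ha, hb, hab⟩ := hmix 0 le_rfl zero_le_one
  have h1 : ∀ x, outcomeProb ρ' MA MB x ≤ 4 ^ l * (a x.1 * b x.2) := fun x => by
    have h2 := hab x
    have h3 := (Finset.single_le_sum (fun y _ => le_max_right _ _) (Finset.mem_univ x)).trans
      ((hpq N hN hle).trans htr)
    have h4 := (le_max_left _ _).trans h3
    linarith
  refine (_root_.mi_mul_log_two_le hp ha hb fun x hx =>
    pos_of_mul_pos_right (hx.trans_le (h1 x)) (by positivity)).trans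
    ((sum_mul_log_sub_log_le hp (by positivity) h1).trans_eq ?_)
  rw [Real.log_pow, show (4 : ℝ) = 2 ^ 2 by norm_num, Real.log_pow]
  push_cast
  ring

/-- Continuity bound in terms of the weight `t` of the excess over the product of marginals. -/
lemma Reach.mi_mul_log_two_le_of_excess {A B : Type} [Fintype A] [DecidableEq A] [Fintype B]
    [DecidableEq B] (hcard : 2 ≤ Fintype.card B) {ρ : Matrix (A × B) (A × B) ℂ}
    (hρ : IsDensity ρ) {l : ℕ}
    {A' B' : Type} [Fintype A'] [DecidableEq A'] [Fintype B'] [DecidableEq B']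
    {ρ' : Matrix (A' × B') (A' × B') ℂ} (h : Reach A B ρ l A' B' ρ')
    {J K : Type} [Fintype J] [Fintype K] {MA : J → Matrix A' A' ℂ} {MB : K → Matrix B' B' ℂ}
    (hA : IsPOVM MA) (hB : IsPOVM MB) {N : Matrix (A × B) (A × B) ℂ} (hN : N.PosSemidef)
    (hle : (trOutB ρ ⊗ₖ trOutA ρ + N - ρ).PosSemidef) {t : ℝ} (ht : 0 < t) (ht' : t ≤ 1 / 2)
    (htr : N.trace.re ≤ t) :
    mi (outcomeProb ρ' MA MB) * Real.log 2 ≤ 2 * l * Real.log 2 +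
      t * Real.log (((Fintype.card B : ℝ) ^ 2 - 1) / t) - (1 - t) * Real.log (1 - t) := by
  have : Nonempty B := Fintype.card_pos_iff.1 (by omega)
  have hc : (2 : ℝ) ≤ Fintype.card B := by exact_mod_cast hcard
  obtain ⟨hp, q, u, hq, hu, hpu, hpq, hmix⟩ := h.exists_compare hρ hA hB
  set D := (Fintype.card B : ℝ) ^ 2 with hD
  have hD4 : 4 ≤ D := by nlinarith
  have hD1 : 0 < D - 1 := by linarith
  have hs : 0 < t * D / (D - 1) := by positivity
  have hs1 : t * D / (D - 1) ≤ 1 := by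
    rw [div_le_one hD1]
    nlinarith
  obtain ⟨a, b, ha, hb, hab⟩ := hmix _ hs.le hs1
  have h1 : ∀ x, 0 < outcomeProb ρ' MA MB x → 0 < a x.1 * b x.2 := fun x hx => by
    have h2 : 0 < u x := pos_of_mul_pos_right (hx.trans_le (hpu x)) (by positivity)
    have h3 : 0 ≤ (1 - t * D / (D - 1)) * q x := mul_nonneg (by linarith) (hq x)
    have h4 : (0 : ℝ) < 4 ^ l * (a x.1 * b x.2) := by
      have := mul_pos hs h2
      linarith [hab x]
    exact pos_of_mul_pos_right h4 (by positivity)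
  refine (_root_.mi_mul_log_two_le hp ha hb h1).trans
    ((sum_mul_log_sub_log_le_of_mix hp hq (by positivity) (by linarith) ht ht' hpu
      ((hpq N hN hle).trans htr) hab).trans_eq ?_)
  rw [Real.log_pow, show (4 : ℝ) = 2 ^ 2 by norm_num, Real.log_pow]
  push_cast
  ring

lemma mul_log_excess_le {D t : ℝ} (hD : 4 ≤ D) (ht : 0 < t) (ht' : t ≤ 1 / 2) :
    t * Real.log ((D - 1) / t) - (1 - t) * Real.log (1 - t) ≤
      2 * t * Real.log D - 2 * t * Real.log (2 * t) := by
  have hD1 : 0 < D - 1 := by linarith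
  have h1t : 0 < 1 - t := by linarith
  have h1 : -((1 - t) * Real.log (1 - t)) ≤ t * (1 - t / 2) := by
    have h2 := mul_le_mul_of_nonneg_left (log_ge_rational h1t) h1t.le
    have h3 : (1 - t) * ((1 - t - 1) * (5 * (1 - t) + 1) / (2 * (1 - t) * (1 - t + 2))) =
        -(t * (6 - 5 * t) / (2 * (3 - t))) := by
      have : 3 - t ≠ 0 := by linarith
      have : 1 - t + 2 ≠ 0 := by linarith
      field_simp
      ring
    have h4 : t * (6 - 5 * t) / (2 * (3 - t)) ≤ t * (1 - t / 2) := by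
      rw [div_le_iff₀ (by linarith)]
      nlinarith [pow_pos ht 3]
    linarith
  have h2 : Real.log t ≤ 2 * t - 1 - Real.log 2 := by
    have := Real.log_le_sub_one_of_pos (show 0 < 2 * t by positivity)
    rw [Real.log_mul (by norm_num) ht.ne'] at this
    linarith
  have h3 : 1 / 4 ≤ 2 * Real.log D - Real.log (D - 1) - 2 * Real.log 2 := by
    have h4 : (4 : ℝ) / 3 ≤ D ^ 2 / ((D - 1) * 2 ^ 2) := by
      rw [div_le_div_iff₀ (by norm_num) (by positivity)]
      nlinarith
    have h5 := Real.one_sub_inv_le_log_of_pos (show (0 : ℝ) < 4 / 3 by norm_num)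
    have h6 := h5.trans (Real.log_le_log (by norm_num) h4)
    rw [Real.log_div (by positivity) (by positivity), Real.log_mul hD1.ne' (by norm_num),
      Real.log_pow, Real.log_pow] at h6
    push_cast at h6
    linarith
  have h4 := Real.log_two_gt_d9
  have h5 : 0 ≤ t * (2 * Real.log D - Real.log (D - 1) - 2 * Real.log 2 - Real.log t -
      (1 - t / 2)) := mul_nonneg ht.le (by linarith)
  rw [Real.log_div hD1.ne' ht.ne', Real.log_mul two_ne_zero ht.ne']
  linarith

lemma mul_log_le_of_le {x M L : ℝ} (hx : 1 ≤ x) (hxM : x ≤ M) (hM : 1 < M)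
    (h : M * Real.log M ≤ 2 * (M - 1) * L) : x * Real.log x ≤ 2 * (x - 1) * L := by
  have hM1 : 0 < M - 1 := by linarith
  have h1 := Real.convexOn_mul_log.2 (show (1 : ℝ) ∈ Set.Ici 0 by simp)
    (show M ∈ Set.Ici 0 by simp; linarith)
    (show 0 ≤ (M - x) / (M - 1) from div_nonneg (by linarith) hM1.le)
    (show 0 ≤ (x - 1) / (M - 1) from div_nonneg (by linarith) hM1.le)
    (by field_simp; ring)
  have h2 : ((M - x) / (M - 1)) • (1 : ℝ) + ((x - 1) / (M - 1)) • M = x := by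
    simp only [smul_eq_mul]
    field_simp
    ring
  rw [h2] at h1
  simp only [Real.log_one, mul_zero, zero_add, smul_eq_mul] at h1
  refine h1.trans ?_
  calc (x - 1) / (M - 1) * (M * Real.log M) ≤ (x - 1) / (M - 1) * (2 * (M - 1) * L) :=
        mul_le_mul_of_nonneg_left h (div_nonneg (by linarith) hM1.le)
    _ = 2 * (x - 1) * L := by field_simp

lemma mul_log_le_of_sq_le {d d' : ℕ} (hd : 2 ≤ d) (hd2 : d' < 2 * d) (h2 : d = 2 → d' = 2) {x : ℝ}
    (hx : 1 ≤ x) (hsq : 3 * x ^ 2 ≤ ((d' : ℝ) + 1) ^ 2) :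
    x * Real.log x ≤ 2 * (x - 1) * Real.log d := by
  have hs3 : Real.sqrt 3 ^ 2 = 3 := Real.sq_sqrt (by norm_num)
  have hs0 : 0 < Real.sqrt 3 := by positivity
  have hs1 : 17 / 10 ≤ Real.sqrt 3 := Real.le_sqrt_of_sq_le (by norm_num)
  have hs2 : Real.sqrt 3 * x ≤ d' + 1 := by
    refine le_of_sq_le_sq ?_ (by positivity)
    rw [mul_pow, hs3]
    exact hsq
  rcases hd.eq_or_lt with rfl | hd3
  · have hd'2 := h2 rfl
    subst hd'2
    refine mul_log_le_of_le (M := Real.sqrt 3) hx ?_ (by linarith) ?_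
    · push_cast at hs2
      nlinarith
    · have h3 : 5 * Real.log 3 ≤ 8 * Real.log 2 := by
        have := Real.log_le_log (by norm_num) (show (3 : ℝ) ^ 5 ≤ 2 ^ 8 by norm_num)
        rw [Real.log_pow, Real.log_pow] at this
        exact_mod_cast this
      have h4 : 0 < Real.log 2 := Real.log_pos (by norm_num)
      rw [Real.log_sqrt (by norm_num)]
      push_cast
      nlinarith [mul_le_mul_of_nonneg_left h3 hs0.le, mul_le_mul_of_nonneg_right hs1 h4.le]
  · have hd3' : (3 : ℝ) ≤ d := by exact_mod_cast hd3
    have hd2' : (d' : ℝ) + 1 ≤ 2 * d := by exact_mod_cast hd2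
    set M := 2 * d / Real.sqrt 3 with hM
    have hMs : M ^ 2 = 4 / 3 * d ^ 2 := by
      rw [hM, div_pow, hs3]; ring
    have hM3 : 3 ≤ M := by
      have : 0 ≤ M := by positivity
      nlinarith
    refine mul_log_le_of_le (M := M) hx ?_ (by linarith) ?_
    · rw [hM, le_div_iff₀ hs0, mul_comm]
      exact hs2.trans hd2'
    · have hL : 1 ≤ Real.log d := by
        rw [Real.le_log_iff_exp_le (by linarith)]
        linarith [Real.exp_one_lt_d9]
      have h3 : 2 * Real.log M ≤ 1 / 3 + 2 * Real.log d := by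
        have h4 := congrArg Real.log hMs
        rw [Real.log_mul (by norm_num) (by positivity), Real.log_pow, Real.log_pow] at h4
        have h5 := Real.log_le_sub_one_of_pos (show (0 : ℝ) < 4 / 3 by norm_num)
        push_cast at h4
        linarith
      nlinarith

lemma le_Ic {n : Type} [Fintype n] [DecidableEq n] [Nonempty n] {ρ : Matrix (n × n) (n × n) ℂ}
    (hρ : IsDensity ρ) {J K : Type} [Fintype J] [Fintype K] {MA : J → Matrix n n ℂ}
    {MB : K → Matrix n n ℂ} (hA : IsPOVM MA) (hB : IsPOVM MB) :
    mi (outcomeProb ρ MA MB) ≤ Ic ρ := by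
  refine le_csSup ⟨2 * Real.log (Fintype.card n) / Real.log 2, ?_⟩
    ⟨J, K, _, _, MA, MB, hA, hB, rfl⟩
  rintro r ⟨J, K, _, _, MA, MB, hA, hB, rfl⟩
  rw [le_div_iff₀ (Real.log_pos (by norm_num))]
  simpa using (Reach.refl ρ).mi_mul_log_two_le hρ hA hB

/-- Theorem 2: if `I_c(ρ)` is small and `ρ'` is obtained from `ρ` by local
operations and `l` qubits of two-way quantum communication, then
`I_c(ρ') − I_c(ρ) ≤ 2l + 2(d'+1)²√(2 I_c(ρ) ln 2) log₂ d + η((d'+1)²√(2 I_c(ρ) ln 2))`,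
where `d' < 2d` is the least prime power `≥ d` and `η(x) = −x log₂ x`. -/
theorem stmt_18 (d d' l : ℕ)
    (hd' : IsPrimePow d') (hdd' : d ≤ d') (hd2 : d' < 2 * d)
    (hleast : ∀ e : ℕ, d ≤ e → IsPrimePow e → d' ≤ e)
    (ρ : Matrix (Fin d × Fin d) (Fin d × Fin d) ℂ) (hρ : IsDensity ρ)
    (hsmall : Ic ρ ≤ 1 / (6 * Real.log 2 * ((d' : ℝ) + 1) ^ 2))
    {A' B' : Type} [Fintype A'] [DecidableEq A'] [Fintype B'] [DecidableEq B']
    (ρ' : Matrix (A' × B') (A' × B') ℂ)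
    (hreach : Reach (Fin d) (Fin d) ρ l A' B' ρ') :
    Ic ρ' - Ic ρ ≤
      2 * l + 2 * ((d' : ℝ) + 1) ^ 2 * Real.sqrt (2 * Ic ρ * Real.log 2) * Real.logb 2 d +
        -((((d' : ℝ) + 1) ^ 2 * Real.sqrt (2 * Ic ρ * Real.log 2)) *
          Real.logb 2 (((d' : ℝ) + 1) ^ 2 * Real.sqrt (2 * Ic ρ * Real.log 2))) := by
  have hlog2 : 0 < Real.log 2 := Real.log_pos (by norm_num)
  have hd : 2 ≤ d := by
    have := hd'.two_le
    omega
  have : Nonempty (Fin d) := ⟨⟨0, by omega⟩⟩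
  have hd'd : d = 2 → d' = 2 := fun h =>
    le_antisymm (hleast 2 h.le Nat.prime_two.isPrimePow) (h ▸ hdd')
  have hE := isPOVM_designPOVM (Fin d)
  have hI : 0 ≤ Ic ρ := (mi_nonneg (isProb_outcomeProb hρ hE hE)).trans (le_Ic hρ hE hE)
  obtain ⟨N, hN, hle, htr⟩ := exists_posSemidef_product_add hρ
  set ε := ((d' : ℝ) + 1) ^ 2 * Real.sqrt (2 * Ic ρ * Real.log 2) with hε
  have hε0 : 0 ≤ ε := by positivity
  have htr' : N.trace.re ≤ ε / 2 := by
    refine htr.trans ?_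
    rw [hε, mul_div_assoc, Fintype.card_fin]
    have := le_Ic hρ hE hE
    gcongr
  have hsq : 3 * ε ^ 2 ≤ ((d' : ℝ) + 1) ^ 2 := by
    rw [hε, mul_pow, Real.sq_sqrt (by positivity)]
    rw [le_div_iff₀ (by positivity)] at hsmall
    nlinarith [mul_le_mul_of_nonneg_left hsmall (sq_nonneg ((d' : ℝ) + 1))]
  have hne : (IcSet ρ').Nonempty := by
    refine ⟨_, Unit, Unit, inferInstance, inferInstance, fun _ => 1, fun _ => 1, ?_, ?_, rfl⟩ <;>
      exact ⟨fun _ => Matrix.PosSemidef.one, by simp⟩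
  refine (sub_le_self _ hI).trans (csSup_le hne ?_)
  rintro r ⟨J, K, _, _, MA, MB, hA, hB, rfl⟩
  have hcard : 2 ≤ Fintype.card (Fin d) := by rwa [Fintype.card_fin]
  have hrhs : (2 * l + 2 * ((d' : ℝ) + 1) ^ 2 * Real.sqrt (2 * Ic ρ * Real.log 2) *
      Real.logb 2 d + -(ε * Real.logb 2 ε)) * Real.log 2 =
        2 * l * Real.log 2 + 2 * ε * Real.log d - ε * Real.log ε := by
    rw [hε, Real.logb, Real.logb]
    field_simp
    ring
  refine le_of_mul_le_mul_right ?_ hlog2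
  rw [hrhs]
  rcases hε0.eq_or_lt with h0 | h0
  · have := hreach.mi_mul_log_two_le_of_product hρ hA hB hN hle (by linarith)
    simpa [← h0] using this
  rcases lt_or_ge ε 1 with h1 | h1
  · have h2 := hreach.mi_mul_log_two_le_of_excess hcard hρ hA hB hN hle (half_pos h0)
      (by linarith) htr'
    have hd4 : (4 : ℝ) ≤ (d : ℝ) ^ 2 := by
      have : (2 : ℝ) ≤ d := by exact_mod_cast hd
      nlinarith
    have h3 := mul_log_excess_le hd4 (half_pos h0) (by linarith)
    rw [Real.log_pow, mul_div_cancel₀ ε two_ne_zero] at h3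
    rw [Fintype.card_fin] at h2
    push_cast at h3
    linarith
  · have h2 := hreach.mi_mul_log_two_le hρ hA hB
    rw [Fintype.card_fin] at h2
    linarith [mul_log_le_of_sq_le hd hd2 hd'd h1 hsq]

end
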